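/- Fix a sequence ρ̄ = (ρ_i)_{i≥1} in (0,1) with all ρ_i ≤ ρ for some fixed ρ ∈ (0,1). Let Λ = {1,2,…}^ℤ with the shift homeomorphism θ and the Bernoulli measure m_P given by an infinite probability vector P = (p₁, p₂, …) with −Σ_j p_j log p_j < ∞; let E = {1,2,…} and ν_Q the Bernoulli measure on E^∞ given by a probability vector Q = (q₁, q₂, …) with −Σ_j q_j log q_j < ∞, and set μ = m_P × ν_Q. For λ = (…, λ_{−1}, λ₀, λ₁, …) ∈ Λ define the contractions φ_n^λ(x) = ρ_{λ_n}·x + (−1)^{λ₀} for n ≥ 1, on a fixed large enough compact interval X, yielding a random infinite IFS S(ρ̄) with overlaps. Then for μ-almost every (λ,ω) ∈ Λ×E^∞ the projection measure μ_λ∘π_λ^{-1} is exact dimensional at π_λ(ω), with pointwise (= Hausdorff = packing) dimension equal to h_μ(S(ρ̄))/χ_μ, where χ_μ = −Σ_{j≥1} p_j log ρ_j, and this dimension satisfies d ≤ (Σ_{i≥1} p_i log p_i + Σ_{j≥1} q_j log q_j)/(Σ_{j≥1} p_j log ρ_j). -/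

import Mathlib

open MeasureTheory Filter Set Metric Function Topology
open scoped ENNReal NNReal

noncomputable section

namespace RIFS

/-- Euclidean space `ℝ^q`. -/
abbrev Pt (q : ℕ) := EuclideanSpace ℝ (Fin q)

/-- The one-sided shift on `E^∞`. -/
def shift {E : Type*} (ω : ℕ → E) : ℕ → E := fun n => ω (n + 1)

/-- The cylinder `[e] = {ω : ω₁ = e}`. -/
def cyl {E : Type*} (e : E) : Set (ℕ → E) := {ω | ω 0 = e}

/-- `B_H(ω, r) = H⁻¹(B(H(ω), r))`. -/
def BH {E β : Type*} [PseudoMetricSpace β] (H : (ℕ → E) → β) (ω : ℕ → E) (r : ℝ) :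
    Set (ℕ → E) := H ⁻¹' Metric.ball (H ω) r

/-- The randomized composition `φ_{ω|_n}^λ = φ_{ω₁}^λ ∘ φ_{ω₂}^{θλ} ∘ ⋯ ∘ φ_{ω_n}^{θ^{n-1}λ}`. -/
def word {Λ E β : Type*} (θ : Λ → Λ) (φ : E → Λ → β → β) :
    Λ → (ℕ → E) → ℕ → β → β
  | _, _, 0 => id
  | l, ω, n + 1 => φ (ω 0) l ∘ word θ φ (θ l) (shift ω) n

/-- The coding map `π_λ(ω) = ⋂_n φ_{ω|_n}^λ(X)`, realized as the limit of
`φ_{ω|_n}^λ(x₀)` for a base point `x₀ ∈ X`. -/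
def proj {Λ E β : Type*} [TopologicalSpace β] [Nonempty β]
    (θ : Λ → Λ) (φ : E → Λ → β → β) (x₀ : β) (l : Λ) (ω : ℕ → E) : β :=
  limUnder atTop fun n => word θ φ l ω n x₀

section Entropy

variable {Λ E β : Type*} [MeasurableSpace Λ] [MeasurableSpace E] [MeasurableSpace β]

/-- The σ-algebra generated by the partition `π_Λ^{-1}(ε_Λ)`. -/
def algL : MeasurableSpace (Λ × (ℕ → E)) := MeasurableSpace.comap Prod.fst inferInstance

/-- The σ-algebra generated by `π_Λ^{-1}(ε_Λ) ∨ π_{ℝ^q}^{-1}(ε_{ℝ^q})`. -/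
def algLpi (π : Λ → (ℕ → E) → β) : MeasurableSpace (Λ × (ℕ → E)) :=
  MeasurableSpace.comap (fun p => (p.1, π p.1 p.2)) inferInstance

/-- The σ-algebra generated by `π_Λ^{-1}(ε_Λ) ∨ (θ×σ)^{-1}(π_{ℝ^q}^{-1}(ε_{ℝ^q}))`. -/
def algLpiT (θ : Λ → Λ) (π : Λ → (ℕ → E) → β) : MeasurableSpace (Λ × (ℕ → E)) :=
  MeasurableSpace.comap (fun p => (p.1, π (θ p.1) (shift p.2))) inferInstance

/-- The information function of the cylinder partition `π_{E^∞}^{-1}(ξ)` with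
respect to a sub-σ-algebra `𝔪`. -/
def condInfoCyl (μ : Measure (Λ × (ℕ → E))) (𝔪 : MeasurableSpace (Λ × (ℕ → E))) :
    Λ × (ℕ → E) → ℝ := fun p =>
  - Real.log ((μ[Set.indicator (Prod.snd ⁻¹' cyl (p.2 0)) (fun _ => (1 : ℝ)) | 𝔪]) p)

/-- Conditional entropy `H_μ(π_{E^∞}^{-1}(ξ) | 𝔪)`. -/
def condEntCyl (μ : Measure (Λ × (ℕ → E))) (𝔪 : MeasurableSpace (Λ × (ℕ → E))) : ℝ :=
  ∫ p, condInfoCyl μ 𝔪 p ∂μ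

/-- The random projectional entropy `h_μ(S)`. -/
def projEnt (θ : Λ → Λ) (π : Λ → (ℕ → E) → β) (μ : Measure (Λ × (ℕ → E))) : ℝ :=
  condEntCyl μ (algLpiT θ π) - condEntCyl μ (algLpi π)

/-- The Lyapunov exponent `χ_μ = -∫ log |(φ_{ω₁}^λ)'(π_{θλ}(σω))| dμ`. -/
def lyap (θ : Λ → Λ) (π : Λ → (ℕ → E) → β) (D : E → Λ → β → ℝ)
    (μ : Measure (Λ × (ℕ → E))) : ℝ :=
  - ∫ p, Real.log (D (p.2 0) p.1 (π (θ p.1) (shift p.2))) ∂μ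

/-- `(μ_λ)_λ` is the Rokhlin disintegration of `μ` over the marginal `m`. -/
structure IsDisint (m : Measure Λ) (μ : Measure (Λ × (ℕ → E)))
    (μd : Λ → Measure (ℕ → E)) : Prop where
  prob : ∀ l, IsProbabilityMeasure (μd l)
  meas : ∀ A : Set (ℕ → E), MeasurableSet A → Measurable fun l => μd l A
  eq : ∀ A : Set (Λ × (ℕ → E)), MeasurableSet A →
    μ A = ∫⁻ l, μd l {ω | (l, ω) ∈ A} ∂m

end Entropy

section KS

variable {α : Type*} [MeasurableSpace α]

/-- A countable measurable partition (indexed by `ℕ`, atoms may be empty). -/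
structure IsPartition (P : ℕ → Set α) : Prop where
  meas : ∀ n, MeasurableSet (P n)
  disj : Pairwise (Function.onFun Disjoint P)
  cover : (⋃ n, P n) = Set.univ

/-- Static entropy of a countable partition. -/
def partEnt (μ : Measure α) (P : ℕ → Set α) : ℝ≥0∞ :=
  ∑' n, ENNReal.ofReal (Real.negMulLog (μ (P n)).toReal)

/-- The atom `⋂_{i<n} T^{-i} P_{k i}` of the dynamical refinement `⋁_{i<n} T^{-i}P`. -/
def refinePart (T : α → α) (P : ℕ → Set α) (n : ℕ) (k : Fin n → ℕ) : Set α :=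
  ⋂ i : Fin n, (T^[(i : ℕ)]) ⁻¹' P (k i)

/-- Dynamical entropy `h(μ, T, P) = lim (1/n) H(⋁_{i<n} T^{-i}P)`. -/
def dynEnt (μ : Measure α) (T : α → α) (P : ℕ → Set α) : ℝ≥0∞ :=
  ⨅ n : ℕ, (∑' k : Fin (n + 1) → ℕ,
    ENNReal.ofReal (Real.negMulLog (μ (refinePart T P (n + 1) k)).toReal)) / (n + 1 : ℝ≥0∞)

/-- Kolmogorov–Sinai entropy `h(μ) = sup_P h(μ, T, P)` over countable measurable
partitions of finite static entropy. -/
def ksEnt (μ : Measure α) (T : α → α) : ℝ≥0∞ :=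
  ⨆ (P : ℕ → Set α) (_ : IsPartition P) (_ : partEnt μ P ≠ ⊤), dynEnt μ T P

end KS

end RIFS

/-- A random countable conformal iterated function system on a compact set
`X ⊆ W ⊆ ℝ^q`, with countable alphabet `E` and parameter space `(Λ, m, θ)`. -/
structure RandomCIFS (q : ℕ) (E : Type*) (Λ : Type*) [MeasurableSpace Λ] where
  m : Measure Λ
  m_prob : IsProbabilityMeasure m
  θ : Λ → Λ
  θ_meas : Measurable θ
  θ_bij : Function.Bijective θ
  θ_mp : MeasurePreserving θ m m
  θ_erg : Ergodic θ m
  X : Set (RIFS.Pt q)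
  W : Set (RIFS.Pt q)
  X_cpt : IsCompact X
  X_conn : IsConnected X
  X_reg : X = closure (interior X)
  W_open : IsOpen W
  W_bdd : Bornology.IsBounded W
  W_conn : IsConnected W
  X_sub_W : X ⊆ W
  s : ℝ
  s_mem : s ∈ Set.Ioo (0 : ℝ) 1
  φ : E → Λ → RIFS.Pt q → RIFS.Pt q
  φ_meas : ∀ e, Measurable fun p : Λ × RIFS.Pt q => φ e p.1 p.2
  φ_inj : ∀ e l, Set.InjOn (φ e l) W
  φ_mapsX : ∀ e l, Set.MapsTo (φ e l) X X
  φ_mapsW : ∀ e l, Set.MapsTo (φ e l) W W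
  φ_lip : ∀ e l, LipschitzOnWith s.toNNReal (φ e l) X
  /-- the conformal derivative modulus `|(φ_e^λ)'(x)|` -/
  D : E → Λ → RIFS.Pt q → ℝ
  φ_conf : ∀ e l x, x ∈ W → ∃ A : RIFS.Pt q →ₗᵢ[ℝ] RIFS.Pt q,
    HasFDerivAt (φ e l) (D e l x • A.toContinuousLinearMap) x
  /-- Bounded Distortion Property -/
  bdp : ∃ K : ℝ → ℝ, K 0 = 1 ∧ Tendsto K (nhdsWithin 0 (Set.Ioi 0)) (nhds 1) ∧
    (∀ t ∈ Set.Ico (0 : ℝ) 1, 1 ≤ K t) ∧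
    ∀ t ∈ Set.Ico (0 : ℝ) 1, ∀ e l x y, x ∈ X →
      ‖y - x‖ ≤ t * Metric.infDist x Wᶜ → D e l y ≤ K t * D e l x

namespace RandomCIFS

variable {q : ℕ} {E Λ : Type*} [MeasurableSpace Λ]

/-- A base point of `X`. -/
def x0 (S : RandomCIFS q E Λ) : RIFS.Pt q := S.X_conn.nonempty.some

/-- The coding maps `π_λ : E^∞ → ℝ^q`. -/
def projMap (S : RandomCIFS q E Λ) : Λ → (ℕ → E) → RIFS.Pt q :=
  RIFS.proj S.θ S.φ S.x0

/-- The limit set `J_λ = π_λ(E^∞)`. -/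
def J (S : RandomCIFS q E Λ) (l : Λ) : Set (RIFS.Pt q) := Set.range (S.projMap l)

/-- The skew product `θ × σ`. -/
def Tmap (S : RandomCIFS q E Λ) : Λ × (ℕ → E) → Λ × (ℕ → E) :=
  fun p => (S.θ p.1, RIFS.shift p.2)

/-- `|(φ_{ω|_n}^λ)'(π_{θ^n λ}(σ^n ω))|`, computed via the chain rule. -/
def Dword (S : RandomCIFS q E Λ) (l : Λ) (ω : ℕ → E) (n : ℕ) : ℝ :=
  ∏ j ∈ Finset.range n,
    S.D (ω j) (S.θ^[j] l) (S.projMap (S.θ^[j + 1] l) (RIFS.shift^[j + 1] ω))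

end RandomCIFS

namespace KahaneSalem

/-- The two-sided shift on `Λ = {1,2,…}^ℤ`. -/
def θz : (ℤ → ℕ) → (ℤ → ℕ) := fun l n => l (n + 1)

/-- The contractions `φ_n^λ(x) = ρ_{λ_n}·x + (−1)^{λ₀}`. -/
def φ (ρ : ℕ → ℝ) (e : ℕ) (l : ℤ → ℕ) (x : ℝ) : ℝ :=
  ρ (l (e + 1)) * x + (-1 : ℝ) ^ (l 0)

/-- `|(φ_e^λ)'(x)| = ρ_{λ_e}`. -/
def Dφ (ρ : ℕ → ℝ) (e : ℕ) (l : ℤ → ℕ) (_ : ℝ) : ℝ := ρ (l (e + 1))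

/-- The coding map of the random infinite IFS `S(ρ̄)`. -/
noncomputable def π (ρ : ℕ → ℝ) : (ℤ → ℕ) → (ℕ → ℕ) → ℝ := RIFS.proj θz (φ ρ) 0

end KahaneSalem

open KahaneSalem RIFS

set_option linter.unusedSectionVars false

namespace KSAux

section Birkhoff

variable {α : Type*} [MeasurableSpace α] {μ : Measure α} {T : α → α}

/-- running maxima of Birkhoff sums -/
def bmax (T : α → α) (f : α → ℝ) : ℕ → α → ℝ
  | 0, _ => 0
  | n + 1, x => max 0 (f x + bmax T f n (T x))

lemma bmax_nonneg (f : α → ℝ) (n : ℕ) (x : α) : 0 ≤ bmax T f n x := by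
  cases n with
  | zero => simp [bmax]
  | succ n => simp [bmax]

lemma bmax_mono_succ (f : α → ℝ) (n : ℕ) : ∀ x : α, bmax T f n x ≤ bmax T f (n + 1) x := by
  induction n with
  | zero => intro x; simp [bmax]
  | succ n ih =>
    intro x
    rw [bmax, bmax]
    exact max_le_max le_rfl (add_le_add le_rfl (ih _))

lemma bmax_mono (f : α → ℝ) (x : α) : Monotone fun n => bmax T f n x :=
  monotone_nat_of_le_succ fun n => bmax_mono_succ f n x

lemma birkhoffSum_le_bmax (f : α → ℝ) (n : ℕ) :
    ∀ x : α, birkhoffSum T f n x ≤ bmax T f n x := by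
  induction n with
  | zero => intro x; simp [bmax]
  | succ n ih =>
    intro x
    rw [birkhoffSum_succ', bmax]
    exact le_max_of_le_right (add_le_add le_rfl (ih _))

lemma bmax_measurable (hT : Measurable T) {f : α → ℝ} (hf : Measurable f) (n : ℕ) :
    Measurable (bmax T f n) := by
  induction n with
  | zero => exact measurable_const
  | succ n ih =>
    exact measurable_const.max (hf.add (ih.comp hT))

lemma bmax_integrable (hT : MeasurePreserving T μ μ) {f : α → ℝ} (hf : Integrable f μ)
    (n : ℕ) : Integrable (bmax T f n) μ := by
  induction n with
  | zero => exact integrable_zero _ _ _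
  | succ n ih =>
    exact (integrable_zero _ _ _).sup (hf.add ((hT.integrable_comp ih.1).2 ih))

lemma birkhoff_bdd [IsProbabilityMeasure μ] (hT : Ergodic T μ) {f : α → ℝ}
    (hf : Measurable f) (hfi : Integrable f μ) (hneg : ∫ x, f x ∂μ < 0) :
    ∀ᵐ x ∂μ, ∃ B, ∀ n, birkhoffSum T f n x ≤ B := by
  set A : Set α := {x | BddAbove (range fun n => bmax T f n x)} with hA
  have hAm : MeasurableSet A :=
    measurableSet_bddAbove_range fun n => bmax_measurable hT.measurable hf n
  have hinv : T ⁻¹' A = A := by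
    ext x
    simp only [hA, mem_preimage, mem_ofPred_eq]
    constructor
    · rintro ⟨B, hB⟩
      refine ⟨max 0 (f x + B), ?_⟩
      rintro _ ⟨n, rfl⟩
      cases n with
      | zero => simp [bmax]
      | succ n =>
        simp only [bmax]
        exact max_le_max le_rfl (add_le_add le_rfl (hB ⟨n, rfl⟩))
    · rintro ⟨B, hB⟩
      refine ⟨B - f x, ?_⟩
      rintro _ ⟨n, rfl⟩
      have := hB ⟨n + 1, rfl⟩
      simp only [bmax] at this
      have h2 := le_trans (le_max_right _ _) this
      simp only
      linarith
  rcases hT.toPreErgodic.ae_mem_or_ae_notMem hAm hinv with h | h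
  · filter_upwards [h] with x hx
    obtain ⟨B, hB⟩ := hx
    exact ⟨B, fun n => (birkhoffSum_le_bmax f n x).trans (hB ⟨n, rfl⟩)⟩
  · exfalso
    have hlim : Tendsto (fun n => ∫ x, (bmax T f (n + 1) x - bmax T f n (T x)) ∂μ) atTop
        (𝓝 (∫ x, f x ∂μ)) := by
      apply tendsto_integral_of_dominated_convergence (fun x => |f x|)
      · intro n
        exact ((bmax_measurable hT.measurable hf _).sub
          ((bmax_measurable hT.measurable hf n).comp hT.measurable)).aestronglyMeasurable
      · exact hfi.abs
      · intro n
        refine Eventually.of_forall fun x => ?_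
        have h0 := bmax_nonneg (T := T) f n (T x)
        rw [Real.norm_eq_abs, bmax]
        rcases le_total 0 (f x + bmax T f n (T x)) with h1 | h1
        · rw [max_eq_right h1]; simp
        · rw [max_eq_left h1, zero_sub, abs_neg, abs_of_nonneg h0]
          have := neg_abs_le (f x)
          linarith
      · filter_upwards [h] with x hx
        have hx' : ¬ BddAbove (range fun n => bmax T f n (T x)) := by
          have : T x ∉ A := by rw [← mem_preimage, hinv]; exact hx
          exact this
        have htop := tendsto_atTop_atTop_of_monotone' (bmax_mono f (T x)) hx'
        apply tendsto_const_nhds.congr'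
        filter_upwards [htop.eventually_ge_atTop (-f x)] with n hn
        rw [bmax, max_eq_right (by linarith)]; ring
    have hpos : ∀ n, 0 ≤ ∫ x, (bmax T f (n + 1) x - bmax T f n (T x)) ∂μ := by
      intro n
      have hi := bmax_integrable hT.toMeasurePreserving hfi
      have e : ∫ x, bmax T f n (T x) ∂μ = ∫ x, bmax T f n x ∂μ := by
        rw [← integral_map hT.measurable.aemeasurable]
        · rw [hT.map_eq]
        · exact (bmax_measurable hT.measurable hf n).aestronglyMeasurable
      have hi2 : Integrable (fun x => bmax T f n (T x)) μ :=
        (hT.toMeasurePreserving.integrable_comp (hi n).1).2 (hi n)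
      rw [integral_sub (hi _) hi2, e,
        ← integral_sub (hi _) (hi _)]
      exact integral_nonneg fun x => sub_nonneg.2 (bmax_mono_succ f n x)
    exact absurd (ge_of_tendsto' hlim hpos) (not_le.2 hneg)

lemma birkhoffSum_sub_const (f : α → ℝ) (c : ℝ) (n : ℕ) (x : α) :
    birkhoffSum T (fun y => f y - c) n x = birkhoffSum T f n x - n * c := by
  simp [birkhoffSum]

lemma birkhoff_limsup [IsProbabilityMeasure μ] (hT : Ergodic T μ) {f : α → ℝ}
    (hf : Measurable f) (hfi : Integrable f μ) {c : ℝ} (hc : ∫ x, f x ∂μ < c) :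
    ∀ᵐ x ∂μ, ∀ᶠ n : ℕ in atTop, birkhoffSum T f n x / n < c := by
  obtain ⟨d, hd1, hd2⟩ := exists_between hc
  have h := birkhoff_bdd hT (f := fun x => f x - d) (hf.sub_const d)
    (hfi.sub (integrable_const d))
    (by rw [integral_sub hfi (integrable_const d)]; simp; linarith)
  filter_upwards [h] with x ⟨B, hB⟩
  have h1 : Tendsto (fun n : ℕ => B / n) atTop (𝓝 0) := tendsto_const_div_atTop_nhds_zero_nat B
  filter_upwards [h1.eventually_lt_const (sub_pos.2 hd2), eventually_gt_atTop 0] with n hn hn0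
  have hn0' : (0 : ℝ) < n := by exact_mod_cast hn0
  have := hB n
  rw [birkhoffSum_sub_const] at this
  rw [div_lt_iff₀ hn0'] at hn ⊢
  nlinarith

theorem birkhoff [IsProbabilityMeasure μ] (hT : Ergodic T μ) {f : α → ℝ}
    (hf : Measurable f) (hfi : Integrable f μ) :
    ∀ᵐ x ∂μ, Tendsto (fun n : ℕ => birkhoffSum T f n x / n) atTop (𝓝 (∫ x, f x ∂μ)) := by
  have h1 : ∀ᵐ x ∂μ, ∀ k : ℕ, ∀ᶠ n : ℕ in atTop,
      birkhoffSum T f n x / n < ∫ x, f x ∂μ + 1 / (k + 1) := by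
    rw [ae_all_iff]; intro k
    exact birkhoff_limsup hT hf hfi (by have := Nat.one_div_pos_of_nat (α := ℝ) (n := k); linarith)
  have h2 : ∀ᵐ x ∂μ, ∀ k : ℕ, ∀ᶠ n : ℕ in atTop,
      birkhoffSum T (-f) n x / n < - ∫ x, f x ∂μ + 1 / (k + 1) := by
    rw [ae_all_iff]; intro k
    refine birkhoff_limsup hT hf.neg hfi.neg ?_
    have := Nat.one_div_pos_of_nat (α := ℝ) (n := k)
    simp only [Pi.neg_apply]
    rw [integral_neg]; linarith
  filter_upwards [h1, h2] with x hx1 hx2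
  rw [tendsto_order]
  constructor
  · intro a ha
    obtain ⟨k, hk⟩ := exists_nat_one_div_lt (sub_pos.2 ha)
    filter_upwards [hx2 k] with n hn
    rw [birkhoffSum_neg, neg_div] at hn
    linarith
  · intro a ha
    obtain ⟨k, hk⟩ := exists_nat_one_div_lt (sub_pos.2 ha)
    filter_upwards [hx1 k] with n hn
    linarith

theorem birkhoff_top [IsProbabilityMeasure μ] (hT : Ergodic T μ) {f : α → ℝ}
    (hf : Measurable f) (hf0 : ∀ x, 0 ≤ f x) (hfi : ¬ Integrable f μ) :
    ∀ᵐ x ∂μ, Tendsto (fun n : ℕ => birkhoffSum T f n x / n) atTop atTop := by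
  set g : ℕ → α → ℝ := fun k x => min (f x) k with hg
  have hgm : ∀ k, Measurable (g k) := fun k => hf.min measurable_const
  have hgi : ∀ k, Integrable (g k) μ := by
    intro k
    refine Integrable.of_bound (hgm k).aestronglyMeasurable (k : ℝ) (Eventually.of_forall fun x => ?_)
    rw [Real.norm_eq_abs, abs_of_nonneg (le_min (hf0 x) (Nat.cast_nonneg k))]
    exact min_le_right _ _
  have hunb : ∀ c : ℝ, ∃ k, c < ∫ x, g k x ∂μ := by
    intro c
    by_contra! hcon
    apply hfi
    refine ⟨hf.aestronglyMeasurable, ?_⟩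
    rw [hasFiniteIntegral_iff_ofReal (Eventually.of_forall hf0)]
    have hlim : Tendsto (fun k => ∫⁻ x, ENNReal.ofReal (g k x) ∂μ) atTop
        (𝓝 (∫⁻ x, ENNReal.ofReal (f x) ∂μ)) := by
      apply lintegral_tendsto_of_tendsto_of_monotone
      · exact fun k => (hgm k).ennreal_ofReal.aemeasurable
      · refine Eventually.of_forall fun x i j hij => ?_
        exact ENNReal.ofReal_le_ofReal (min_le_min le_rfl (Nat.cast_le.2 hij))
      · refine Eventually.of_forall fun x => ?_
        apply tendsto_const_nhds.congr'
        obtain ⟨K, hK⟩ := exists_nat_ge (f x)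
        filter_upwards [eventually_ge_atTop K] with k hk
        simp only [hg]
        rw [min_eq_left (hK.trans (Nat.cast_le.2 hk))]
    refine lt_of_le_of_lt (le_of_tendsto' hlim (b := ENNReal.ofReal c) fun k => ?_)
      ENNReal.ofReal_lt_top
    rw [← ofReal_integral_eq_lintegral_ofReal (hgi k)
      (Eventually.of_forall fun x => le_min (hf0 x) (Nat.cast_nonneg k))]
    exact ENNReal.ofReal_le_ofReal (hcon k)
  have hall : ∀ᵐ x ∂μ, ∀ k, Tendsto (fun n : ℕ => birkhoffSum T (g k) n x / n) atTop
      (𝓝 (∫ x, g k x ∂μ)) := ae_all_iff.2 fun k => birkhoff hT (hgm k) (hgi k)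
  filter_upwards [hall] with x hx
  rw [Filter.tendsto_atTop]
  intro c
  obtain ⟨k, hk⟩ := hunb c
  filter_upwards [(hx k).eventually_const_lt hk] with n hn
  refine hn.le.trans (div_le_div_of_nonneg_right ?_ (Nat.cast_nonneg n))
  exact Finset.sum_le_sum fun i _ => min_le_left _ _

/-- Maker's theorem -/
theorem maker [IsProbabilityMeasure μ] (hT : Ergodic T μ) {g : ℕ → α → ℝ} {f G : α → ℝ}
    (hg : ∀ n, Measurable (g n)) (hf : Measurable f) (hG : Measurable G) (hGi : Integrable G μ)
    (hgG : ∀ᵐ x ∂μ, ∀ n, |g n x| ≤ G x)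
    (hlim : ∀ᵐ x ∂μ, Tendsto (fun n => g n x) atTop (𝓝 (f x))) :
    ∀ᵐ x ∂μ, Tendsto (fun n : ℕ => (∑ k ∈ Finset.range n, g (n - k) (T^[k] x)) / n) atTop
      (𝓝 (∫ x, f x ∂μ)) := by
  have hfG : ∀ᵐ x ∂μ, |f x| ≤ G x := by
    filter_upwards [hgG, hlim] with x h1 h2
    exact le_of_tendsto' h2.abs h1
  have hfi : Integrable f μ := hGi.mono' hf.aestronglyMeasurable hfG
  -- envelope of tails
  set D : ℕ → α → ℝ := fun N x => ⨆ j, |g (N + j) x - f x| with hD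
  have hDm : ∀ N, Measurable (D N) := fun N =>
    Measurable.iSup fun j => ((hg _).sub hf).abs
  have hbd : ∀ᵐ x ∂μ, ∀ N j, |g (N + j) x - f x| ≤ 2 * G x := by
    filter_upwards [hgG, hfG] with x h1 h2 N j
    have := abs_sub (g (N + j) x) (f x)
    have := h1 (N + j)
    linarith
  have hDle : ∀ᵐ x ∂μ, ∀ N, D N x ≤ 2 * G x := by
    filter_upwards [hbd] with x hx N
    exact ciSup_le (hx N)
  have hD0 : ∀ N x, 0 ≤ D N x := fun N x => Real.iSup_nonneg fun j => abs_nonneg _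
  have hDi : ∀ N, Integrable (D N) μ := fun N =>
    (hGi.const_mul 2).mono' (hDm N).aestronglyMeasurable (by
      filter_upwards [hDle] with x hx
      rw [Real.norm_eq_abs, abs_of_nonneg (hD0 N x)]; exact hx N)
  have hDlim : Tendsto (fun N => ∫ x, D N x ∂μ) atTop (𝓝 0) := by
    rw [← integral_zero α ℝ (μ := μ)]
    apply tendsto_integral_of_dominated_convergence (fun x => 2 * G x)
    · exact fun N => (hDm N).aestronglyMeasurable
    · exact hGi.const_mul 2
    · intro N
      filter_upwards [hDle] with x hx
      rw [Real.norm_eq_abs, abs_of_nonneg (hD0 N x)]; exact hx N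
    · filter_upwards [hlim] with x hx
      rw [Metric.tendsto_atTop]
      intro ε hε
      obtain ⟨N, hN⟩ := (Metric.tendsto_atTop.1 hx) (ε / 2) (half_pos hε)
      refine ⟨N, fun n hn => ?_⟩
      rw [Real.dist_eq, sub_zero, abs_of_nonneg (hD0 n x)]
      refine lt_of_le_of_lt (ciSup_le fun j => ?_) (half_lt_self hε)
      exact (hN (n + j) (by omega)).le
  have hall : ∀ᵐ x ∂μ, ∀ N, Tendsto (fun n : ℕ => birkhoffSum T (D N) n x / n) atTop
      (𝓝 (∫ x, D N x ∂μ)) := ae_all_iff.2 fun N => birkhoff hT (hDm N) (hDi N)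
  have horb : ∀ᵐ x ∂μ, ∀ k N j, |g (N + j) (T^[k] x) - f (T^[k] x)| ≤ 2 * G (T^[k] x) := by
    rw [ae_all_iff]; intro k
    exact (hT.toMeasurePreserving.iterate k).quasiMeasurePreserving.tendsto_ae.eventually hbd
  have hGb := birkhoff hT hG hGi
  filter_upwards [birkhoff hT hf hfi, hall, horb, hGb] with x hx1 hx2 hx3 hx4
  -- G (T^[n] x) / n → 0
  have hGn : Tendsto (fun n : ℕ => G (T^[n] x) / n) atTop (𝓝 0) := by
    have h1 : Tendsto (fun n : ℕ => birkhoffSum T G (n + 1) x / ((n + 1 : ℕ) : ℝ)) atTop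
      (𝓝 (∫ x, G x ∂μ)) := hx4.comp (tendsto_add_atTop_nat 1)
    have h2 : Tendsto (fun n : ℕ => ((n + 1 : ℕ) : ℝ) / n) atTop (𝓝 1) := by
      have : Tendsto (fun n : ℕ => 1 + (1 : ℝ) / n) atTop (𝓝 (1 + 0)) :=
        tendsto_const_nhds.add (tendsto_const_div_atTop_nhds_zero_nat 1)
      rw [add_zero] at this
      apply this.congr'
      filter_upwards [eventually_gt_atTop 0] with n hn
      have : (n : ℝ) ≠ 0 := by exact_mod_cast hn.ne'
      push_cast; field_simp
    have h3 := (h1.mul h2).sub hx4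
    rw [mul_one, sub_self] at h3
    apply h3.congr'
    filter_upwards [eventually_gt_atTop 0] with n hn
    have : (n : ℝ) ≠ 0 := by exact_mod_cast hn.ne'
    have h' : ((n + 1 : ℕ) : ℝ) ≠ 0 := by positivity
    rw [birkhoffSum_succ]; field_simp; ring
  have htail : ∀ N : ℕ, Tendsto (fun n : ℕ => (∑ i ∈ Finset.range N,
      2 * |G (T^[n - 1 - i] x)|) / n) atTop (𝓝 0) := by
    intro N
    simp_rw [Finset.sum_div]
    suffices hs : ∀ i ∈ Finset.range N, Tendsto (fun n : ℕ =>
        2 * |G (T^[n - 1 - i] x)| / (n : ℝ)) atTop (𝓝 0) by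
      simpa using tendsto_finsetSum _ hs
    intro i _
    have h1 : Tendsto (fun n : ℕ => n - 1 - i) atTop atTop := by
      refine Filter.tendsto_atTop.2 fun b => ?_
      filter_upwards [eventually_ge_atTop (b + 1 + i)] with n hn
      omega
    have h2 := ((hGn.comp h1).abs.const_mul 2)
    rw [abs_zero, mul_zero] at h2
    refine squeeze_zero' (Eventually.of_forall fun n => by positivity) ?_ h2
    filter_upwards [eventually_ge_atTop (i + 2)] with n hn
    simp only [comp_apply]
    rw [abs_div, mul_div_assoc]
    refine mul_le_mul_of_nonneg_left ?_ (by norm_num)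
    have hp : (0 : ℝ) < ((n - 1 - i : ℕ) : ℝ) := by
      have : 0 < n - 1 - i := by omega
      exact_mod_cast this
    rw [abs_of_pos hp]
    refine div_le_div_of_nonneg_left (abs_nonneg _) hp ?_
    exact_mod_cast (by omega : n - 1 - i ≤ n)
  have key : Tendsto (fun n : ℕ => (∑ k ∈ Finset.range n, g (n - k) (T^[k] x)) / n -
      birkhoffSum T f n x / n) atTop (𝓝 0) := by
    rw [Metric.tendsto_atTop]
    intro ε hε
    have : ∃ N, ∫ x, D N x ∂μ < ε / 2 := (hDlim.eventually_lt_const (half_pos hε)).exists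
    obtain ⟨N, hN⟩ := this
    have e1 := (hx2 N).eventually_lt_const hN
    have e2 := (htail N).eventually_lt_const (half_pos hε)
    obtain ⟨M, hM⟩ := eventually_atTop.1 (e1.and (e2.and (eventually_ge_atTop (N + 1))))
    refine ⟨M, fun n hn => ?_⟩
    obtain ⟨h1, h2, h3⟩ := hM n hn
    have hn0 : (0 : ℝ) < n := by exact_mod_cast (by omega : 0 < n)
    rw [Real.dist_eq, sub_zero, ← sub_div, abs_div, abs_of_pos hn0]
    have hb : |(∑ k ∈ Finset.range n, g (n - k) (T^[k] x)) - birkhoffSum T f n x| ≤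
        birkhoffSum T (D N) n x + ∑ i ∈ Finset.range N, 2 * |G (T^[n - 1 - i] x)| := by
      rw [birkhoffSum, ← Finset.sum_sub_distrib]
      refine (Finset.abs_sum_le_sum_abs _ _).trans ?_
      rw [birkhoffSum]
      have hsum : ∑ i ∈ Finset.range N, 2 * |G (T^[n - 1 - i] x)| =
          ∑ k ∈ Finset.range n, if n - k ≤ N then 2 * |G (T^[k] x)| else 0 := by
        rw [← Finset.sum_range_reflect (fun k => if n - k ≤ N then 2 * |G (T^[k] x)| else 0) n,
          ← Finset.sum_filter_add_sum_filter_not (Finset.range n) (fun i => i < N)]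
        rw [Finset.sum_eq_zero (s := Finset.filter (fun i => ¬ i < N) _), add_zero]
        · have : Finset.filter (fun i => i < N) (Finset.range n) = Finset.range N := by
            ext i; simp; omega
          rw [this]
          refine Finset.sum_congr rfl fun i hi => ?_
          rw [Finset.mem_range] at hi
          rw [if_pos (by omega)]
        · intro i hi
          simp at hi
          rw [if_neg (by omega)]
      rw [hsum, ← Finset.sum_add_distrib]
      refine Finset.sum_le_sum fun k hk => ?_
      rw [Finset.mem_range] at hk
      by_cases hkN : n - k ≤ N
      · rw [if_pos hkN]
        have a1 := hx3 k (n - k) 0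
        rw [add_zero] at a1
        have a2 := hD0 N (T^[k] x)
        have a3 := le_abs_self (G (T^[k] x))
        linarith
      · rw [if_neg hkN, add_zero]
        have a1 : |g (N + (n - k - N)) (T^[k] x) - f (T^[k] x)| ≤ D N (T^[k] x) := by
          refine le_ciSup (f := fun j => |g (N + j) (T^[k] x) - f (T^[k] x)|) ?_ (n - k - N)
          refine ⟨2 * G (T^[k] x), ?_⟩
          rintro _ ⟨j, rfl⟩
          exact hx3 k N j
        rwa [show N + (n - k - N) = n - k by omega] at a1
    rw [div_lt_iff₀ hn0] at h1 h2 ⊢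
    linarith
  have := key.add hx1
  rw [zero_add] at this
  simpa using this

end Birkhoff

end KSAux

namespace KSAux

section Ergodicity

open ProbabilityTheory

lemma ergodic_of_approx {α : Type*} [MeasurableSpace α] {μ : Measure α} [IsProbabilityMeasure μ]
    {T : α → α} (hT : MeasurePreserving T μ μ)
    (C : Set (Set α)) (hC : ∀ A, MeasurableSet A → ∀ ε : ℝ≥0∞, 0 < ε → ∃ B ∈ C, MeasurableSet B ∧ μ (symmDiff B A) < ε)
    (hmix : ∀ B ∈ C, ∃ N : ℕ, μ (B ∩ T^[N] ⁻¹' B) = μ B * μ B) : Ergodic T μ := by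
  refine ⟨hT, ⟨fun {A} hA hinv => ?_⟩⟩
  have hinvN : ∀ N, T^[N] ⁻¹' A = A := by
    intro N
    induction N with
    | zero => rfl
    | succ N ih => rw [iterate_succ', preimage_comp, hinv, ih]
  have key : μ.real A = μ.real A * μ.real A := by
    by_contra hne
    have hpos : 0 < |μ.real A - μ.real A * μ.real A| := abs_pos.2 (sub_ne_zero.2 hne)
    set ε := |μ.real A - μ.real A * μ.real A| / 8 with hε
    have hε0 : 0 < ε := by positivity
    obtain ⟨B, hBC, hBm, hB⟩ := hC A hA (ENNReal.ofReal ε) (by simpa using hε0)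
    obtain ⟨N, hN⟩ := hmix B hBC
    have hBr : μ.real (symmDiff B A) < ε := by
      rw [measureReal_def]
      exact ENNReal.toReal_lt_of_lt_ofReal hB
    have h1 : |μ.real B - μ.real A| ≤ μ.real (symmDiff B A) :=
      abs_measureReal_sub_le_measureReal_symmDiff hBm.nullMeasurableSet hA.nullMeasurableSet
    have h2 : |μ.real (B ∩ T^[N] ⁻¹' B) - μ.real (A ∩ T^[N] ⁻¹' A)| ≤ 
        μ.real (symmDiff (B ∩ T^[N] ⁻¹' B) (A ∩ T^[N] ⁻¹' A)) :=
      abs_measureReal_sub_le_measureReal_symmDiff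
        (hBm.inter ((hT.iterate N).measurable hBm)).nullMeasurableSet
        (hA.inter ((hT.iterate N).measurable hA)).nullMeasurableSet
    have h3 : symmDiff (B ∩ T^[N] ⁻¹' B) (A ∩ T^[N] ⁻¹' A) ⊆
        symmDiff B A ∪ T^[N] ⁻¹' (symmDiff B A) := by
      intro x hx
      simp only [mem_symmDiff, mem_inter_iff, mem_preimage, mem_union] at hx ⊢
      tauto
    have h4 : μ.real (T^[N] ⁻¹' (symmDiff B A)) = μ.real (symmDiff B A) := by
      rw [measureReal_def, (hT.iterate N).measure_preimage (hBm.symmDiff hA).nullMeasurableSet,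
        measureReal_def]
    have h5 := (measureReal_mono h3 (by finiteness) : μ.real _ ≤ μ.real _).trans (measureReal_union_le _ _)
    rw [hinvN, inter_self] at h2
    rw [hinvN, inter_self] at h5
    have h6 : μ.real (B ∩ T^[N] ⁻¹' B) = μ.real B * μ.real B := by
      simp only [measureReal_def, hN, ENNReal.toReal_mul]
    rw [h6] at h2
    have a0 : 0 ≤ μ.real A := measureReal_nonneg
    have a1 : μ.real A ≤ 1 := measureReal_le_one
    have b0 : 0 ≤ μ.real B := measureReal_nonneg
    have b1 : μ.real B ≤ 1 := measureReal_le_one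
    have h7 : |μ.real A - μ.real A * μ.real A| ≤ 4 * ε := by
      have e1 : |μ.real B * μ.real B - μ.real A| ≤ 2 * ε := by linarith
      have e2 : |μ.real B * μ.real B - μ.real A * μ.real A| ≤ 2 * ε := by
        rw [show μ.real B * μ.real B - μ.real A * μ.real A =
          (μ.real B - μ.real A) * (μ.real B + μ.real A) by ring, abs_mul, abs_of_nonneg (by linarith : 0 ≤ μ.real B + μ.real A)]
        have := abs_nonneg (μ.real B - μ.real A)
        nlinarith
      rw [abs_le] at *
      constructor <;> linarith
    linarith
  have : μ.real A = 0 ∨ μ.real A = 1 := by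
    have : μ.real A * (1 - μ.real A) = 0 := by linarith
    rcases mul_eq_zero.1 this with h | h
    · exact Or.inl h
    · exact Or.inr (by linarith)
  rw [Filter.eventuallyConst_set']
  rcases this with h | h
  · left
    rw [measureReal_eq_zero_iff] at h
    exact ae_eq_empty.2 h
  · right
    have : μ A = 1 := by
      rw [measureReal_def, ENNReal.toReal_eq_one_iff] at h; exact h
    exact ae_eq_univ.2 ((prob_compl_eq_zero_iff hA).2 this)

lemma ergodic_reindex {ι : Type*} (R : ι → Measure ℕ) [∀ i, IsProbabilityMeasure (R i)]
    (s : ι → ι) (hs : Injective s) (hR : ∀ i, R (s i) = R i)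
    (hdis : ∀ S : Finset ι, ∃ N, ∀ i ∈ S, s^[N] i ∉ S) :
    Ergodic (fun (x : ι → ℕ) i => x (s i)) (Measure.infinitePi R) := by
  classical
  set T : (ι → ℕ) → (ι → ℕ) := fun x i => x (s i) with hTdef
  have hTm : Measurable T := measurable_pi_lambda _ fun i => measurable_pi_apply _
  have hTi : ∀ N x i, T^[N] x i = x (s^[N] i) := by
    intro N
    induction N with
    | zero => intro x i; rfl
    | succ N ih =>
      intro x i
      rw [iterate_succ_apply, ih, hTdef, iterate_succ_apply']
  have hmp : MeasurePreserving T (Measure.infinitePi R) (Measure.infinitePi R) := by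
    refine ⟨hTm, ?_⟩
    apply Measure.eq_infinitePi
    intro S t ht
    rw [Measure.map_apply hTm (MeasurableSet.pi (Finset.countable_toSet S) fun i _ => ht i)]
    have : T ⁻¹' (Set.pi (S : Set ι) t) =
        Set.pi ((S.image s : Finset ι) : Set ι) (fun j => t (if h : ∃ i, s i = j then h.choose else j)) := by
      ext x
      simp only [mem_preimage, Set.mem_pi, Finset.coe_image, mem_image, Finset.mem_coe, hTdef]
      constructor
      · rintro h _ ⟨i, hi, rfl⟩
        have h' : ∃ k, s k = s i := ⟨i, rfl⟩
        rw [dif_pos h', hs h'.choose_spec]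
        exact h i hi
      · intro h i hi
        have := h (s i) ⟨i, hi, rfl⟩
        have h' : ∃ k, s k = s i := ⟨i, rfl⟩
        rwa [dif_pos h', hs h'.choose_spec] at this
    rw [this, Measure.infinitePi_pi _ (fun i _ => ht _), Finset.prod_image (fun a _ b _ h => hs h)]
    refine Finset.prod_congr rfl fun i _ => ?_
    have h' : ∃ k, s k = s i := ⟨i, rfl⟩
    rw [dif_pos h', hs h'.choose_spec, hR]
  have hind : iIndepFun (fun (i : ι) (x : ι → ℕ) => x i) (Measure.infinitePi R) := by
    rw [iIndepFun_iff_map_fun_eq_infinitePi_map (by fun_prop)]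
    simp only [Measure.infinitePi_map_eval]
    exact Measure.map_id
  refine ergodic_of_approx hmp (measurableCylinders fun _ : ι => ℕ) ?_ ?_
  · intro A hA ε hε
    obtain ⟨B, hB, hB2⟩ := exists_measure_symmDiff_lt_of_generateFrom_isSetRing
      (μ := Measure.infinitePi R) (C := measurableCylinders fun _ : ι => ℕ)
      isSetRing_measurableCylinders
      ⟨{univ}, countable_singleton _, by
        simpa only [singleton_subset_iff] using univ_mem_measurableCylinders _, by simp⟩ generateFrom_measurableCylinders.symm hA hε
    exact ⟨B, hB, MeasurableSet.of_mem_measurableCylinders hB, hB2⟩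
  · intro B hB
    rw [mem_measurableCylinders] at hB
    obtain ⟨S, D, hD, rfl⟩ := hB
    obtain ⟨N, hN⟩ := hdis S
    refine ⟨N, ?_⟩
    have hsN : Injective (s^[N]) := hs.iterate N
    have hd : Disjoint S (S.image s^[N]) := by
      rw [Finset.disjoint_right]
      intro j hj
      rw [Finset.mem_image] at hj
      obtain ⟨i, hi, rfl⟩ := hj
      exact hN i hi
    have h1 := hind.indepFun_finset S (S.image s^[N]) hd (by fun_prop)
    set u : ((S.image s^[N] : Finset ι) → ℕ) → (S → ℕ) :=
      fun y i => y ⟨s^[N] i, Finset.mem_image_of_mem _ i.2⟩ with hu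
    have hum : Measurable u := measurable_pi_lambda _ fun i => measurable_pi_apply _
    have h2 := h1.comp measurable_id hum
    have h3 := h2.measure_inter_preimage_eq_mul D D hD hD
    have e1 : (id ∘ fun (x : ι → ℕ) (i : S) => x i) ⁻¹' D = cylinder S D := rfl
    have e2 : (u ∘ fun (x : ι → ℕ) (i : (S.image s^[N] : Finset ι)) => x i) ⁻¹' D =
        T^[N] ⁻¹' (cylinder S D) := by
      ext x
      simp only [mem_preimage, cylinder]
      rw [show (u ∘ fun (x : ι → ℕ) (i : (S.image s^[N] : Finset ι)) => x i) x =
        S.restrict (T^[N] x) from ?_]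
      ext i
      simp [hu, hTi]
    rw [e1, e2] at h3
    rw [h3, (hmp.iterate N).measure_preimage (MeasurableSet.cylinder S hD).nullMeasurableSet]

/-- the probability measure on `ℕ` with a given mass function -/
def pm (p : ℕ → ℝ) : Measure ℕ := Measure.sum fun i => ENNReal.ofReal (p i) • Measure.dirac i

lemma pm_singleton (p : ℕ → ℝ) (j : ℕ) : pm p {j} = ENNReal.ofReal (p j) := by
  rw [pm, Measure.sum_apply _ (measurableSet_singleton j), tsum_eq_single j]
  · simp
  · intro i hi
    simp [hi]

lemma summable_of_tsum_one {p : ℕ → ℝ} (hp1 : ∑' i, p i = 1) : Summable p := by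
  by_contra h
  rw [tsum_eq_zero_of_not_summable h] at hp1
  exact zero_ne_one hp1

lemma pm_prob {p : ℕ → ℝ} (hp0 : ∀ i, 0 ≤ p i) (hp1 : ∑' i, p i = 1) :
    IsProbabilityMeasure (pm p) := by
  constructor
  rw [pm, Measure.sum_apply _ MeasurableSet.univ]
  simp only [Measure.smul_apply, measure_univ, smul_eq_mul, mul_one]
  rw [← ENNReal.ofReal_tsum_of_nonneg hp0 (summable_of_tsum_one hp1), hp1, ENNReal.ofReal_one]

lemma eq_pi_of_cyl {ι : Type*} {p : ℕ → ℝ} [IsProbabilityMeasure (pm p)]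
    (m : Measure (ι → ℕ))
    (hm : ∀ (s : Finset ι) (a : ι → ℕ),
      m {l | ∀ i ∈ s, l i = a i} = ∏ i ∈ s, ENNReal.ofReal (p (a i))) :
    m = Measure.infinitePi fun _ => pm p := by
  classical
  refine IsProjectiveLimit.unique (fun s => ?_) (Measure.isProjectiveLimit_infinitePi _)
  refine Measure.ext_of_singleton fun a => ?_
  rw [Measure.map_apply (by fun_prop) (measurableSet_singleton a), Measure.pi_singleton]
  have : (s.restrict : (ι → ℕ) → (s → ℕ)) ⁻¹' {a} = {l : ι → ℕ | ∀ i ∈ s, l i = (fun j => if h : j ∈ s then a ⟨j, h⟩ else 0) i} := by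
    ext l
    simp only [mem_preimage, mem_singleton_iff, mem_ofPred_eq]
    constructor
    · rintro rfl i hi
      simp [hi]
    · intro h
      ext i
      have := h i i.2
      simpa using this
  rw [this, hm, ← Finset.prod_coe_sort]
  refine Finset.prod_congr rfl fun i _ => ?_
  simp [pm_singleton]

lemma eq_pi_of_cyl_nat {p : ℕ → ℝ} [IsProbabilityMeasure (pm p)]
    (m : Measure (ℕ → ℕ)) 
    (hm : ∀ (n : ℕ) (a : Fin n → ℕ),
      m {ω | ∀ i : Fin n, ω (i : ℕ) = a i} = ∏ i : Fin n, ENNReal.ofReal (p (a i))) :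
    m = Measure.infinitePi fun _ => pm p := by
  classical
  refine IsProjectiveLimit.unique (P := fun I : Finset ℕ => Measure.pi fun _ : I => pm p) ?_
    (Measure.isProjectiveLimit_infinitePi _)
  rw [isProjectiveLimit_nat_iff (isProjectiveMeasureFamily_pi fun _ : ℕ => pm p)]
  intro n
  refine Measure.ext_of_singleton fun a => ?_
  rw [Measure.map_apply (by fun_prop) (measurableSet_singleton a), Measure.pi_singleton]
  have : (Preorder.frestrictLe n : (ℕ → ℕ) → (Finset.Iic n → ℕ)) ⁻¹' {a} = {l : ℕ → ℕ | ∀ i : Fin (n + 1), l i =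
      a ⟨i, Finset.mem_Iic.2 (Nat.lt_succ_iff.1 i.2)⟩} := by
    ext l
    simp only [mem_preimage, mem_singleton_iff, mem_ofPred_eq]
    constructor
    · rintro rfl i
      rfl
    · intro h
      ext i
      exact h ⟨i, Nat.lt_succ_iff.2 (Finset.mem_Iic.1 i.2)⟩
  rw [this, hm]
  simp only [pm_singleton]
  refine Finset.prod_bij' (fun i _ => ⟨i, Finset.mem_Iic.2 (Nat.lt_succ_iff.1 i.2)⟩)
    (fun i _ => ⟨i, Nat.lt_succ_iff.2 (Finset.mem_Iic.1 i.2)⟩) ?_ ?_ ?_ ?_ ?_ <;> simp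

end Ergodicity

end KSAux

namespace KSAux

section Model

/-- the skew product -/
def TT : (ℤ → ℕ) × (ℕ → ℕ) → (ℤ → ℕ) × (ℕ → ℕ) := fun x => (θz x.1, RIFS.shift x.2)

lemma θz_meas : Measurable θz := measurable_pi_lambda _ fun _ => measurable_pi_apply _
lemma shift_meas : Measurable (RIFS.shift : (ℕ → ℕ) → (ℕ → ℕ)) :=
  measurable_pi_lambda _ fun _ => measurable_pi_apply _

lemma cyl_meas (e : ℕ) : MeasurableSet (cyl e : Set (ℕ → ℕ)) :=
  measurableSet_eq_fun (measurable_pi_apply 0) measurable_const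

lemma TT_meas : Measurable TT :=
  (θz_meas.comp measurable_fst).prodMk (shift_meas.comp measurable_snd)

lemma TT_iter_fst (n : ℕ) (x : (ℤ → ℕ) × (ℕ → ℕ)) : (TT^[n] x).1 = θz^[n] x.1 := by
  induction n generalizing x with
  | zero => rfl
  | succ n ih => rw [iterate_succ_apply, ih, iterate_succ_apply]; rfl

lemma TT_iter_snd (n : ℕ) (x : (ℤ → ℕ) × (ℕ → ℕ)) (k : ℕ) : (TT^[n] x).2 k = x.2 (n + k) := by
  induction n generalizing x with
  | zero => simp
  | succ n ih => rw [iterate_succ_apply, ih]; simp only [TT, RIFS.shift]; rw [show n + k + 1 = n + 1 + k by omega]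

lemma TT_ergodic {p q : ℕ → ℝ} [IsProbabilityMeasure (pm p)] [IsProbabilityMeasure (pm q)] :
    Ergodic TT ((Measure.infinitePi fun _ : ℤ => pm p).prod
      (Measure.infinitePi fun _ : ℕ => pm q)) := by
  classical
  set R : ℤ ⊕ ℕ → Measure ℕ := Sum.elim (fun _ => pm p) (fun _ => pm q) with hR
  have : ∀ i, IsProbabilityMeasure (R i) := by
    rintro (i | i) <;> simp only [hR, Sum.elim_inl, Sum.elim_inr] <;> infer_instance
  set s : ℤ ⊕ ℕ → ℤ ⊕ ℕ := Sum.map (· + 1) (· + 1) with hs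
  have hsN : ∀ N : ℕ, s^[N] = Sum.map (· + (N : ℤ)) (· + N) := by
    intro N
    induction N with
    | zero => ext i; rcases i with i | i <;> simp
    | succ N ih =>
      ext i
      rw [iterate_succ_apply', ih]
      rcases i with i | i <;> simp [hs, add_assoc]
  have herg := ergodic_reindex R s
    (by
      rw [hs]
      exact Sum.map_injective.2 ⟨add_left_injective 1, add_left_injective 1⟩)
    (by rintro (i | i) <;> rfl)
    (by
      intro S
      obtain ⟨B, hB⟩ := (S.image (Sum.elim (fun i : ℤ => i.natAbs) id)).bddAbove
      refine ⟨2 * B + 1, fun i hi hi2 => ?_⟩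
      have h1 := hB (Finset.mem_coe.2 (Finset.mem_image_of_mem _ hi))
      have h2 := hB (Finset.mem_coe.2 (Finset.mem_image_of_mem _ hi2))
      rw [hsN] at h2
      rcases i with i | i <;> simp at h1 h2 <;> omega)
  set e : (ℤ ⊕ ℕ → ℕ) → (ℤ → ℕ) × (ℕ → ℕ) := fun x => (fun i => x (Sum.inl i), fun i => x (Sum.inr i))
    with he
  set e' : (ℤ → ℕ) × (ℕ → ℕ) → (ℤ ⊕ ℕ → ℕ) := fun y => Sum.elim y.1 y.2 with he'
  have hem : Measurable e := by
    refine Measurable.prodMk ?_ ?_ <;> exact measurable_pi_lambda _ fun i => measurable_pi_apply _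
  have hem' : Measurable e' := by
    refine measurable_pi_lambda _ ?_
    rintro (i | i)
    · exact (measurable_pi_apply i).comp measurable_fst
    · exact (measurable_pi_apply i).comp measurable_snd
  have hee' : e ∘ e' = id := by ext y <;> rfl
  have hmap : ((Measure.infinitePi fun _ : ℤ => pm p).prod
      (Measure.infinitePi fun _ : ℕ => pm q)).map e' = Measure.infinitePi R := by
    apply Measure.eq_infinitePi
    intro S t ht
    rw [Measure.map_apply hem' (MeasurableSet.pi (Finset.countable_toSet S) fun i _ => ht i)]
    have : e' ⁻¹' (Set.pi (S : Set (ℤ ⊕ ℕ)) t) =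
        (Set.pi (S.toLeft : Set ℤ) fun i => t (Sum.inl i)) ×ˢ
        (Set.pi (S.toRight : Set ℕ) fun i => t (Sum.inr i)) := by
      ext y
      simp [he', Set.mem_pi]
    rw [this, Measure.prod_prod, Measure.infinitePi_pi _ (fun i _ => ht _),
      Measure.infinitePi_pi _ (fun i _ => ht _)]
    conv_rhs => rw [← Finset.toLeft_disjSum_toRight (u := S), Finset.prod_disjSum]
    rfl
  have hmp : MeasurePreserving e (Measure.infinitePi R) ((Measure.infinitePi fun _ : ℤ => pm p).prod
      (Measure.infinitePi fun _ : ℕ => pm q)) := by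
    refine ⟨hem, ?_⟩
    rw [← hmap, Measure.map_map hem hem', hee', Measure.map_id]
  exact hmp.ergodic_of_ergodic_semiconj herg TT_meas (by intro x; rfl)

lemma pm_apply_nu_shift {q : ℕ → ℝ} [IsProbabilityMeasure (pm q)]
    (e : ℕ) {B : Set (ℕ → ℕ)} (hB : MeasurableSet B) :
    (Measure.infinitePi fun _ : ℕ => pm q) (cyl e ∩ RIFS.shift ⁻¹' B) =
      ENNReal.ofReal (q e) * (Measure.infinitePi fun _ : ℕ => pm q) B := by
  set ν := Measure.infinitePi fun _ : ℕ => pm q with hν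
  set c : ℕ × (ℕ → ℕ) → (ℕ → ℕ) := fun y n => Nat.casesOn n y.1 y.2 with hc
  have hcm : Measurable c := by
    refine measurable_pi_lambda _ fun n => ?_
    cases n with
    | zero => exact measurable_fst
    | succ n => exact (measurable_pi_apply n).comp measurable_snd
  have hcyl : ∀ (n : ℕ) (a : Fin n → ℕ),
      ν {ω | ∀ i : Fin n, ω (i : ℕ) = a i} = ∏ i : Fin n, ENNReal.ofReal (q (a i)) := by
    intro n a
    have : {ω : ℕ → ℕ | ∀ i : Fin n, ω (i : ℕ) = a i} =
        Set.pi ((Finset.range n : Finset ℕ) : Set ℕ) (fun i => if h : i < n then {a ⟨i, h⟩} else univ) := by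
      ext ω
      simp only [mem_ofPred_eq, Set.mem_pi, Finset.coe_range, mem_Iio]
      constructor
      · intro h i hi; rw [dif_pos hi]; exact h ⟨i, hi⟩
      · intro h i; have := h i i.2; rwa [dif_pos i.2] at this
    rw [this, hν, Measure.infinitePi_pi _ (fun i _ => MeasurableSet.of_discrete), ← Fin.prod_univ_eq_prod_range
      (fun i => pm q (if h : i < n then {a ⟨i, h⟩} else univ))]
    refine Finset.prod_congr rfl fun i _ => ?_
    rw [dif_pos i.2, pm_singleton]
  have hmap : ((pm q).prod ν).map c = ν := by
    apply eq_pi_of_cyl_nat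
    intro n a
    have hm : MeasurableSet {ω : ℕ → ℕ | ∀ i : Fin n, ω (i : ℕ) = a i} := by
      simp only [Set.ofPred_forall]
      exact MeasurableSet.iInter fun i => measurableSet_eq_fun (measurable_pi_apply _) measurable_const
    rw [Measure.map_apply hcm hm]
    cases n with
    | zero =>
      simp
    | succ n =>
      have : c ⁻¹' {ω : ℕ → ℕ | ∀ i : Fin (n + 1), ω (i : ℕ) = a i} =
          {a 0} ×ˢ {ω : ℕ → ℕ | ∀ i : Fin n, ω (i : ℕ) = a i.succ} := by
        ext y
        simp only [mem_preimage, mem_ofPred_eq, mem_prod, mem_singleton_iff]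
        rw [Fin.forall_fin_succ]
        simp [hc]
      rw [this, Measure.prod_prod, pm_singleton, hcyl, Fin.prod_univ_succ]
  have hm : MeasurableSet (cyl e ∩ RIFS.shift ⁻¹' B) :=
    (cyl_meas e).inter (shift_meas hB)
  conv_lhs => rw [← hmap]
  rw [Measure.map_apply hcm hm]
  have : c ⁻¹' (cyl e ∩ RIFS.shift ⁻¹' B) = {e} ×ˢ B := by
    ext y
    simp only [mem_preimage, mem_inter_iff, cyl, mem_ofPred_eq, mem_prod, mem_singleton_iff]
    rfl
  rw [this, Measure.prod_prod, pm_singleton]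

/-- the index selecting the contraction ratio -/
def ix (x : (ℤ → ℕ) × (ℕ → ℕ)) : ℕ := x.1 ((x.2 0 : ℤ) + 1)

lemma ix_meas : Measurable ix := by
  refine measurable_to_countable' fun j => ?_
  have : ix ⁻¹' {j} = ⋃ e : ℕ, {x : (ℤ → ℕ) × (ℕ → ℕ) | x.2 0 = e} ∩
      {x : (ℤ → ℕ) × (ℕ → ℕ) | x.1 ((e : ℤ) + 1) = j} := by
    ext x
    simp [ix]
  rw [this]
  refine MeasurableSet.iUnion fun e => MeasurableSet.inter ?_ ?_
  · exact measurableSet_eq_fun ((measurable_pi_apply 0).comp measurable_snd) measurable_const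
  · exact measurableSet_eq_fun ((measurable_pi_apply _).comp measurable_fst) measurable_const

lemma ix_map {p q : ℕ → ℝ} [IsProbabilityMeasure (pm p)] [IsProbabilityMeasure (pm q)] :
    ((Measure.infinitePi fun _ : ℤ => pm p).prod
      (Measure.infinitePi fun _ : ℕ => pm q)).map ix = pm p := by
  refine Measure.ext_of_singleton fun j => ?_
  have hm : MeasurableSet (ix ⁻¹' {j}) := ix_meas (measurableSet_singleton j)
  rw [Measure.map_apply ix_meas (measurableSet_singleton j), Measure.prod_apply_symm hm]
  have : ∀ ω : ℕ → ℕ, (Measure.infinitePi fun _ : ℤ => pm p)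
      ((fun l => (l, ω)) ⁻¹' (ix ⁻¹' {j})) = pm p {j} := by
    intro ω
    have := (measurePreserving_eval_infinitePi (fun _ : ℤ => pm p) ((ω 0 : ℤ) + 1)).measure_preimage
      (measurableSet_singleton j).nullMeasurableSet
    exact this
  simp only [this, lintegral_const, measure_univ, mul_one]

lemma ev0_map {p q : ℕ → ℝ} [IsProbabilityMeasure (pm p)] [IsProbabilityMeasure (pm q)] :
    ((Measure.infinitePi fun _ : ℤ => pm p).prod
      (Measure.infinitePi fun _ : ℕ => pm q)).map (fun x => x.2 0) = pm q := by
  have h1 := (measurePreserving_snd (μ := (Measure.infinitePi fun _ : ℤ => pm p))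
    (ν := (Measure.infinitePi fun _ : ℕ => pm q)))
  exact ((measurePreserving_eval_infinitePi (fun _ : ℕ => pm q) 0).comp h1).map_eq

lemma integrable_pm {p : ℕ → ℝ} (hp0 : ∀ i, 0 ≤ p i) (f : ℕ → ℝ) :
    Integrable f (pm p) ↔ Summable fun j => p j * |f j| := by
  rw [pm, integrable_sum_dirac_iff (fun i => ENNReal.ofReal_ne_top)]
  simp only [ENNReal.toReal_ofReal (hp0 _), Real.norm_eq_abs]

lemma integral_pm {p : ℕ → ℝ} (hp0 : ∀ i, 0 ≤ p i) (f : ℕ → ℝ) :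
    ∫ j, f j ∂(pm p) = ∑' j, p j * f j := by
  rw [pm, integral_sum_dirac (fun i => ENNReal.ofReal_ne_top)]
  simp only [ENNReal.toReal_ofReal (hp0 _), smul_eq_mul]

/-- the contraction ratio -/
def dd (ρ : ℕ → ℝ) (x : (ℤ → ℕ) × (ℕ → ℕ)) : ℝ := ρ (ix x)

lemma dd_meas (ρ : ℕ → ℝ) : Measurable (dd ρ) := (measurable_of_countable ρ).comp ix_meas

/-- products of contraction ratios -/
def RR (ρ : ℕ → ℝ) (n : ℕ) (x : (ℤ → ℕ) × (ℕ → ℕ)) : ℝ := ∏ k ∈ Finset.range n, dd ρ (TT^[k] x)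

lemma RR_succ (ρ : ℕ → ℝ) (n : ℕ) (x : (ℤ → ℕ) × (ℕ → ℕ)) :
    RR ρ (n + 1) x = dd ρ x * RR ρ n (TT x) := by
  rw [RR, Finset.prod_range_succ', mul_comm]; rfl

lemma RR_meas (ρ : ℕ → ℝ) (n : ℕ) : Measurable (RR ρ n) :=
  Finset.measurable_fun_prod _ fun k _ => (dd_meas ρ).comp (TT_meas.iterate k)

/-- finite approximations of the coding map -/
def ww (ρ : ℕ → ℝ) (n : ℕ) (x : (ℤ → ℕ) × (ℕ → ℕ)) : ℝ := word θz (φ ρ) x.1 x.2 n 0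

lemma ww_succ (ρ : ℕ → ℝ) (n : ℕ) (x : (ℤ → ℕ) × (ℕ → ℕ)) :
    ww ρ (n + 1) x = dd ρ x * ww ρ n (TT x) + (-1 : ℝ) ^ (x.1 0) := rfl

lemma ww_meas (ρ : ℕ → ℝ) (n : ℕ) : Measurable (ww ρ n) := by
  induction n with
  | zero => exact measurable_const
  | succ n ih =>
    have : ww ρ (n + 1) = fun x => dd ρ x * ww ρ n (TT x) + (-1 : ℝ) ^ (x.1 0) := by
      ext x; exact ww_succ ρ n x
    rw [this]
    refine ((dd_meas ρ).mul (ih.comp TT_meas)).add ?_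
    exact (measurable_of_countable fun k : ℕ => (-1 : ℝ) ^ k).comp
      ((measurable_pi_apply 0).comp measurable_fst)

section Coding

variable {ρ : ℕ → ℝ} {ρbar : ℝ} (hρ : ∀ i, ρ i ∈ Set.Ioo (0 : ℝ) 1)
    (hρbar : ρbar ∈ Set.Ioo (0 : ℝ) 1) (hρle : ∀ i, ρ i ≤ ρbar)

include hρ hρbar hρle

lemma RR_pos (n : ℕ) (x : (ℤ → ℕ) × (ℕ → ℕ)) : 0 < RR ρ n x :=
  Finset.prod_pos fun k _ => (hρ _).1

lemma RR_le (n : ℕ) (x : (ℤ → ℕ) × (ℕ → ℕ)) : RR ρ n x ≤ ρbar ^ n := by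
  exact (Finset.prod_le_prod (fun _ _ => (hρ _).1.le) (fun _ _ => hρle _)).trans_eq (by simp)

lemma ww_diff (n : ℕ) : ∀ x : (ℤ → ℕ) × (ℕ → ℕ), |ww ρ n x - ww ρ (n + 1) x| ≤ ρbar ^ n := by
  induction n with
  | zero =>
    intro x
    rw [ww_succ]
    have h0 : ∀ y, ww ρ 0 y = 0 := fun _ => rfl
    rw [h0, h0]
    simp
  | succ n ih =>
    intro x
    rw [ww_succ, ww_succ]
    rw [show dd ρ x * ww ρ n (TT x) + (-1 : ℝ) ^ (x.1 0) - (dd ρ x * ww ρ (n + 1) (TT x) +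
      (-1 : ℝ) ^ (x.1 0)) = dd ρ x * (ww ρ n (TT x) - ww ρ (n + 1) (TT x)) by ring, abs_mul,
      abs_of_pos (show 0 < dd ρ x from (hρ _).1), pow_succ']
    exact mul_le_mul (hρle _) (ih _) (abs_nonneg _) hρbar.1.le

lemma ww_bd (n : ℕ) : ∀ x : (ℤ → ℕ) × (ℕ → ℕ), |ww ρ n x| ≤ 1 / (1 - ρbar) := by
  have h1 : 0 < 1 - ρbar := sub_pos.2 hρbar.2
  induction n with
  | zero =>
    intro x
    have h0 : ww ρ 0 x = 0 := rfl
    rw [h0, abs_zero]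
    positivity
  | succ n ih =>
    intro x
    rw [ww_succ]
    refine (abs_add_le _ _).trans ?_
    rw [abs_mul, abs_of_pos (show 0 < dd ρ x from (hρ _).1), abs_pow, abs_neg, abs_one, one_pow]
    have := mul_le_mul (hρle (ix x)) (ih (TT x)) (abs_nonneg _) hρbar.1.le
    have e : ρbar * (1 / (1 - ρbar)) + 1 = 1 / (1 - ρbar) := by field_simp; ring
    rw [← e]
    exact add_le_add this le_rfl

lemma ww_tendsto (x : (ℤ → ℕ) × (ℕ → ℕ)) :
    Tendsto (fun n => ww ρ n x) atTop (𝓝 (KahaneSalem.π ρ x.1 x.2)) := by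
  have hc : CauchySeq fun n => ww ρ n x := by
    refine cauchySeq_of_le_geometric ρbar 1 hρbar.2 fun n => ?_
    rw [Real.dist_eq, one_mul]
    exact ww_diff hρ hρbar hρle n x
  obtain ⟨y, hy⟩ := cauchySeq_tendsto_of_complete hc
  have : KahaneSalem.π ρ x.1 x.2 = y := hy.limUnder_eq
  rw [this]; exact hy

lemma pi_rec (x : (ℤ → ℕ) × (ℕ → ℕ)) : KahaneSalem.π ρ x.1 x.2 =
    dd ρ x * KahaneSalem.π ρ (TT x).1 (TT x).2 + (-1 : ℝ) ^ (x.1 0) := by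
  have h1 := (ww_tendsto hρ hρbar hρle x).comp (tendsto_add_atTop_nat 1)
  have h2 := ((ww_tendsto hρ hρbar hρle (TT x)).const_mul (dd ρ x)).add_const ((-1 : ℝ) ^ (x.1 0))
  exact tendsto_nhds_unique h1 h2

lemma pi_bd (x : (ℤ → ℕ) × (ℕ → ℕ)) : |KahaneSalem.π ρ x.1 x.2| ≤ 1 / (1 - ρbar) :=
  le_of_tendsto' (ww_tendsto hρ hρbar hρle x).abs fun n => ww_bd hρ hρbar hρle n x

lemma pi_meas : Measurable fun x : (ℤ → ℕ) × (ℕ → ℕ) => KahaneSalem.π ρ x.1 x.2 :=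
  measurable_of_tendsto_metrizable (ww_meas ρ)
    (tendsto_pi_nhds.2 fun x => ww_tendsto hρ hρbar hρle x)

end Coding

end Model
end KSAux

namespace KSAux

section Maximal

lemma besi_max : ∃ Nb : ℕ, ∀ (a b : Measure ℝ) (R : ℝ) (t : ℝ≥0∞) (s : Set ℝ) (r : ℝ → ℝ),
    (∀ x ∈ s, 0 < r x) → (∀ x ∈ s, r x ≤ R) →
    (∀ x ∈ s, a (closedBall x (r x)) ≤ t * b (closedBall x (r x))) →
    a s ≤ Nb * (t * b univ) := by
  obtain ⟨N, τ, hτ, hN⟩ := HasBesicovitchCovering.no_satelliteConfig (α := ℝ)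
  refine ⟨N, fun a b R t s r h0 hR hab => ?_⟩
  let pk : Besicovitch.BallPackage s ℝ :=
    { c := fun x => x
      r := fun x => r x
      rpos := fun x => h0 x x.2
      r_bound := R
      r_le := fun x => hR x x.2 }
  obtain ⟨u, hu, hu'⟩ := Besicovitch.exist_disjoint_covering_families hτ hN pk
  have u_count : ∀ i, (u i).Countable := by
    intro i
    refine (hu i).countable_of_nonempty_interior fun j _ => ?_
    have : (ball (j : ℝ) (r j)).Nonempty := nonempty_ball.2 (pk.rpos _)
    exact this.mono ball_subset_interior_closedBall
  have hsub : s ⊆ ⋃ i : Fin N, ⋃ j ∈ u i, closedBall (j : ℝ) (r j) := by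
    intro x hx
    have : x ∈ range pk.c := ⟨⟨x, hx⟩, rfl⟩
    have h2 := hu' this
    simp only [mem_iUnion] at h2 ⊢
    obtain ⟨i, j, hj, h3⟩ := h2
    exact ⟨i, j, hj, ball_subset_closedBall h3⟩
  calc a s ≤ a (⋃ i : Fin N, ⋃ j ∈ u i, closedBall (j : ℝ) (r j)) := measure_mono hsub
    _ ≤ ∑ i : Fin N, a (⋃ j ∈ u i, closedBall (j : ℝ) (r j)) := measure_iUnion_fintype_le _ _
    _ ≤ ∑ i : Fin N, t * b univ := by
      refine Finset.sum_le_sum fun i _ => ?_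
      calc a (⋃ j ∈ u i, closedBall (j : ℝ) (r j))
          ≤ ∑' j : u i, a (closedBall (j : ℝ) (r j)) := measure_biUnion_le _ (u_count i) _
        _ ≤ ∑' j : u i, t * b (closedBall (j : ℝ) (r j)) :=
          ENNReal.tsum_le_tsum fun j => hab _ j.1.2
        _ = t * ∑' j : u i, b (closedBall (j : ℝ) (r j)) := ENNReal.tsum_mul_left
        _ = t * b (⋃ j ∈ u i, closedBall (j : ℝ) (r j)) := by
          rw [measure_biUnion (u_count i) (hu i) fun j _ => measurableSet_closedBall]
        _ ≤ t * b univ := by gcongr; exact subset_univ _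
    _ = N * (t * b univ) := by simp

variable {L : Type*} [MeasurableSpace L] {m : Measure L} [IsProbabilityMeasure m]
  {ν : Measure (ℕ → ℕ)} [IsProbabilityMeasure ν] {P : L → (ℕ → ℕ) → ℝ}

/-- preimages of closed balls -/
def BB (P : L → (ℕ → ℕ) → ℝ) (x : L × (ℕ → ℕ)) (r : ℝ) : Set (ℕ → ℕ) :=
  P x.1 ⁻¹' closedBall (P x.1 x.2) r

/-- mass of a ball -/
def NN (ν : Measure (ℕ → ℕ)) (P : L → (ℕ → ℕ) → ℝ) (x : L × (ℕ → ℕ)) (r : ℝ) : ℝ≥0∞ :=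
  ν (BB P x r)

/-- mass of a ball intersected with a cylinder -/
def NE (ν : Measure (ℕ → ℕ)) (P : L → (ℕ → ℕ) → ℝ) (e : ℕ) (x : L × (ℕ → ℕ)) (r : ℝ) : ℝ≥0∞ :=
  ν (cyl e ∩ BB P x r)

/-- mass of a ball intersected with the cylinder of the centre -/
def NC (ν : Measure (ℕ → ℕ)) (P : L → (ℕ → ℕ) → ℝ) (x : L × (ℕ → ℕ)) (r : ℝ) : ℝ≥0∞ :=
  NE ν P (x.2 0) x r

lemma NE_le (e : ℕ) (x : L × (ℕ → ℕ)) (r : ℝ) : NE ν P e x r ≤ NN ν P x r :=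
  measure_mono inter_subset_right

lemma BB_meas_joint (hP : Measurable fun x : L × (ℕ → ℕ) => P x.1 x.2) {r : L × (ℕ → ℕ) → ℝ}
    (hr : Measurable r) :
    MeasurableSet {z : (L × (ℕ → ℕ)) × (ℕ → ℕ) | z.2 ∈ BB P z.1 (r z.1)} := by
  have h1 : Measurable fun z : (L × (ℕ → ℕ)) × (ℕ → ℕ) => P z.1.1 z.2 :=
    hP.comp ((measurable_fst.comp measurable_fst).prodMk measurable_snd)
  have h2 : Measurable fun z : (L × (ℕ → ℕ)) × (ℕ → ℕ) => P z.1.1 z.1.2 := hP.comp measurable_fst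
  exact measurableSet_le (h1.dist h2) (hr.comp measurable_fst)

lemma NN_meas (hP : Measurable fun x : L × (ℕ → ℕ) => P x.1 x.2) {r : L × (ℕ → ℕ) → ℝ}
    (hr : Measurable r) : Measurable fun x => NN ν P x (r x) :=
  measurable_measure_prodMk_left (BB_meas_joint hP hr)

lemma NE_meas (hP : Measurable fun x : L × (ℕ → ℕ) => P x.1 x.2) {r : L × (ℕ → ℕ) → ℝ}
    (hr : Measurable r) (e : ℕ) : Measurable fun x => NE ν P e x (r x) :=
  measurable_measure_prodMk_left (ν := ν) ((measurable_snd (cyl_meas e)).inter (BB_meas_joint hP hr))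

lemma meas_lab {β : Type*} [MeasurableSpace β] {F : ℕ → L × (ℕ → ℕ) → β}
    (hF : ∀ e, Measurable (F e)) : Measurable fun x : L × (ℕ → ℕ) => F (x.2 0) x := by
  have : Measurable fun z : (L × (ℕ → ℕ)) × ℕ => F z.2 z.1 :=
    measurable_from_prod_countable_left fun e => hF e
  exact this.comp (measurable_id.prodMk ((measurable_pi_apply 0).comp measurable_snd))

lemma NC_meas (hP : Measurable fun x : L × (ℕ → ℕ) => P x.1 x.2) {r : L × (ℕ → ℕ) → ℝ}
    (hr : Measurable r) : Measurable fun x => NC ν P x (r x) :=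
  meas_lab (F := fun e x => NE ν P e x (r x)) fun e => NE_meas hP hr e

lemma P_meas (hP : Measurable fun x : L × (ℕ → ℕ) => P x.1 x.2) (l : L) : Measurable (P l) :=
  hP.comp measurable_prodMk_left

/-- the maximal inequality -/
lemma max_ineq : ∃ Nb : ℕ, ∀ (L : Type) [MeasurableSpace L] (m : Measure L) [IsProbabilityMeasure m]
    (ν : Measure (ℕ → ℕ)) [IsProbabilityMeasure ν] (P : L → (ℕ → ℕ) → ℝ)
    (_ : Measurable fun x : L × (ℕ → ℕ) => P x.1 x.2) (R : ℝ) (r : ℕ → L × (ℕ → ℕ) → ℝ)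
    (_ : ∀ n, Measurable (r n)) (_ : ∀ n x, 0 < r n x) (_ : ∀ n x, r n x ≤ R) (e : ℕ) (t : ℝ≥0∞),
    (m.prod ν) {x | x.2 ∈ cyl e ∧ ∃ n, NC ν P x (r n x) ≤ t * NN ν P x (r n x)} ≤ Nb * t := by
  obtain ⟨Nb, hNb⟩ := besi_max
  refine ⟨Nb, fun L _ m _ ν _ P hP R r hr hr0 hrR e t => ?_⟩
  have hPl := P_meas hP
  have hm : MeasurableSet {x : L × (ℕ → ℕ) | x.2 ∈ cyl e ∧
      ∃ n, NC ν P x (r n x) ≤ t * NN ν P x (r n x)} := by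
    have h2 : MeasurableSet (⋃ n, {x : L × (ℕ → ℕ) | NC ν P x (r n x) ≤ t * NN ν P x (r n x)}) :=
      MeasurableSet.iUnion fun n =>
      measurableSet_le (NC_meas hP (hr n)) ((NN_meas hP (hr n)).const_mul t)
    convert! (measurable_snd (cyl_meas e)).inter h2 using 1
    ext x
    simp
  rw [Measure.prod_apply hm]
  have key : ∀ l : L, ν (Prod.mk l ⁻¹' {x : L × (ℕ → ℕ) | x.2 ∈ cyl e ∧
      ∃ n, NC ν P x (r n x) ≤ t * NN ν P x (r n x)}) ≤ Nb * t := by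
    intro l
    set A : Set (ℕ → ℕ) := Prod.mk l ⁻¹' {x : L × (ℕ → ℕ) | x.2 ∈ cyl e ∧
      ∃ n, NC ν P x (r n x) ≤ t * NN ν P x (r n x)} with hA
    have hAc : ∀ ω ∈ A, ω ∈ cyl e ∧
      ∃ n, NC ν P (l, ω) (r n (l, ω)) ≤ t * NN ν P (l, ω) (r n (l, ω)) := fun ω h => h
    set a : Measure ℝ := (ν.restrict (cyl e)).map (P l) with ha
    set b : Measure ℝ := ν.map (P l) with hb
    have hsel : ∀ y ∈ P l '' A, ∃ rr : ℝ, 0 < rr ∧ rr ≤ R ∧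
        a (closedBall y rr) ≤ t * b (closedBall y rr) := by
      rintro y ⟨ω, hω, rfl⟩
      obtain ⟨h1, n, h2⟩ := hAc ω hω
      refine ⟨r n (l, ω), hr0 _ _, hrR _ _, ?_⟩
      rw [ha, hb, Measure.map_apply (hPl l) measurableSet_closedBall,
        Measure.map_apply (hPl l) measurableSet_closedBall,
        Measure.restrict_apply (hPl l measurableSet_closedBall), inter_comm]
      have h3 : ω 0 = e := h1
      simp only [NC, h3] at h2
      exact h2
    choose! rr h1 h2 h3 using hsel
    have hfin := hNb a b R t (P l '' A) rr h1 h2 h3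
    have hb1 : b univ = 1 := by
      rw [hb, Measure.map_apply (hPl l) MeasurableSet.univ, preimage_univ, measure_univ]
    rw [hb1, mul_one] at hfin
    refine le_trans ?_ hfin
    calc ν A ≤ ν ((P l ⁻¹' (P l '' A)) ∩ cyl e) :=
          measure_mono fun ω h => ⟨subset_preimage_image _ _ h, (hAc ω h).1⟩
      _ ≤ (ν.restrict (cyl e)) (P l ⁻¹' (P l '' A)) := Measure.le_restrict_apply _ _
      _ ≤ a (P l '' A) := Measure.le_map_apply (hPl l).aemeasurable _
  calc _ ≤ ∫⁻ _ : L, Nb * t ∂m := lintegral_mono key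
    _ = Nb * t := by simp

end Maximal
end KSAux

namespace KSAux

section MaximalInt

variable {L : Type} [MeasurableSpace L] {m : Measure L} [IsProbabilityMeasure m]
  {ν : Measure (ℕ → ℕ)} [IsProbabilityMeasure ν] {P : L → (ℕ → ℕ) → ℝ}

/-- infimum of the conditional ratios -/
def ps (ν : Measure (ℕ → ℕ)) (P : L → (ℕ → ℕ) → ℝ) (r : ℕ → L × (ℕ → ℕ) → ℝ)
    (x : L × (ℕ → ℕ)) : ℝ≥0∞ := ⨅ n, NC ν P x (r n x) / NN ν P x (r n x)

lemma ps_meas (hP : Measurable fun x : L × (ℕ → ℕ) => P x.1 x.2) {r : ℕ → L × (ℕ → ℕ) → ℝ}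
    (hr : ∀ n, Measurable (r n)) : Measurable (ps ν P r) :=
  Measurable.iInf fun n => (NC_meas hP (hr n)).div (NN_meas hP (hr n))

lemma ps_max : ∃ Nb : ℕ, ∀ (L : Type) [MeasurableSpace L] (m : Measure L) [IsProbabilityMeasure m]
    (ν : Measure (ℕ → ℕ)) [IsProbabilityMeasure ν] (P : L → (ℕ → ℕ) → ℝ)
    (_ : Measurable fun x : L × (ℕ → ℕ) => P x.1 x.2) (R : ℝ) (r : ℕ → L × (ℕ → ℕ) → ℝ)
    (_ : ∀ n, Measurable (r n)) (_ : ∀ n x, 0 < r n x) (_ : ∀ n x, r n x ≤ R) (e : ℕ) (t : ℝ≥0∞),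
    (m.prod ν) {x | x.2 ∈ cyl e ∧ ps ν P r x < t} ≤ Nb * t := by
  obtain ⟨Nb, hNb⟩ := max_ineq
  refine ⟨Nb, fun L _ m _ ν _ P hP R r hr hr0 hrR e t => ?_⟩
  refine le_trans (measure_mono ?_) (hNb L m ν P hP R r hr hr0 hrR e t)
  rintro x ⟨h1, h2⟩
  refine ⟨h1, ?_⟩
  obtain ⟨n, hn⟩ := iInf_lt_iff.1 h2
  refine ⟨n, ?_⟩
  by_cases h0 : NN ν P x (r n x) = 0
  · have := NE_le (ν := ν) (P := P) (x.2 0) x (r n x)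
    rw [h0] at this
    exact this.trans zero_le
  · exact (ENNReal.div_le_iff h0 (measure_ne_top _ _)).1 hn.le

lemma ps_ne_zero (hP : Measurable fun x : L × (ℕ → ℕ) => P x.1 x.2) {R : ℝ}
    {r : ℕ → L × (ℕ → ℕ) → ℝ}
    (hr : ∀ n, Measurable (r n)) (hr0 : ∀ n x, 0 < r n x) (hrR : ∀ n x, r n x ≤ R) :
    ∀ᵐ x ∂(m.prod ν), ps ν P r x ≠ 0 := by
  obtain ⟨Nb, hNb⟩ := ps_max
  have h : ∀ e : ℕ, (m.prod ν) {x | x.2 ∈ cyl e ∧ ps ν P r x = 0} = 0 := by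
    intro e
    have hle : ∀ k : ℕ, (m.prod ν) {x | x.2 ∈ cyl e ∧ ps ν P r x = 0} ≤
        Nb * ((k : ℝ≥0∞) + 1)⁻¹ := by
      intro k
      refine le_trans (measure_mono ?_) (hNb L m ν P hP R r hr hr0 hrR e _)
      rintro x ⟨h1, h2⟩
      refine ⟨h1, ?_⟩
      rw [h2]
      exact ENNReal.inv_pos.2 (by finiteness)
    have hlim : Tendsto (fun k : ℕ => (Nb : ℝ≥0∞) * ((k : ℝ≥0∞) + 1)⁻¹) atTop (𝓝 (Nb * 0)) := by
      refine ENNReal.Tendsto.const_mul ?_ (Or.inr (by finiteness))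
      have := (tendsto_add_atTop_iff_nat 1).2 ENNReal.tendsto_inv_nat_nhds_zero
      simpa using this
    rw [mul_zero] at hlim
    exact le_antisymm (ge_of_tendsto' hlim hle) zero_le
  rw [ae_iff]
  refine measure_mono_null ?_ (measure_iUnion_null h)
  intro x hx
  simp only [mem_ofPred_eq, not_not] at hx
  exact mem_iUnion.2 ⟨x.2 0, rfl, hx⟩

/-- the integrable envelope -/
def GG (ν : Measure (ℕ → ℕ)) (P : L → (ℕ → ℕ) → ℝ) (r : ℕ → L × (ℕ → ℕ) → ℝ)
    (x : L × (ℕ → ℕ)) : ℝ := - Real.log (ps ν P r x).toReal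

lemma ps_le_one (r : ℕ → L × (ℕ → ℕ) → ℝ) (x : L × (ℕ → ℕ)) : ps ν P r x ≤ 1 := by
  refine (iInf_le _ 0).trans ?_
  exact ENNReal.div_le_of_le_mul (by rw [one_mul]; exact NE_le _ _ _)

lemma GG_meas (hP : Measurable fun x : L × (ℕ → ℕ) => P x.1 x.2) {r : ℕ → L × (ℕ → ℕ) → ℝ}
    (hr : ∀ n, Measurable (r n)) : Measurable (GG ν P r) :=
  (Real.measurable_log.comp (ps_meas hP hr).ennreal_toReal).neg

lemma GG_nonneg (r : ℕ → L × (ℕ → ℕ) → ℝ) (x : L × (ℕ → ℕ)) : 0 ≤ GG ν P r x := by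
  have : (ps ν P r x).toReal ≤ 1 := by
    have := ENNReal.toReal_mono ENNReal.one_ne_top (ps_le_one (ν := ν) (P := P) r x)
    simpa using this
  exact neg_nonneg.2 (Real.log_nonpos ENNReal.toReal_nonneg this)

lemma layer_bound (q : ℝ) (hq0 : 0 ≤ q) (hq1 : q ≤ 1) (Nb : ℕ) :
    ∫⁻ t in Ioi (0 : ℝ), min (ENNReal.ofReal q) (Nb * ENNReal.ofReal (Real.exp (-t))) ≤
      ENNReal.ofReal (Real.negMulLog q) + Nb * ENNReal.ofReal q := by
  rcases hq0.eq_or_lt with h | h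
  · rw [← h]; simp
  set s0 : ℝ := - Real.log q with hs0
  have hs0n : 0 ≤ s0 := neg_nonneg.2 (Real.log_nonpos hq0 hq1)
  have hcov : Ioi (0 : ℝ) ⊆ Ioc 0 s0 ∪ Ioi s0 := by
    intro t ht
    by_cases h : t ≤ s0
    · exact Or.inl ⟨ht, h⟩
    · exact Or.inr (not_le.1 h)
  calc _ ≤ ∫⁻ t in Ioc 0 s0 ∪ Ioi s0, min (ENNReal.ofReal q) (Nb * ENNReal.ofReal (Real.exp (-t))) :=
        lintegral_mono_set hcov
    _ ≤ (∫⁻ t in Ioc 0 s0, min (ENNReal.ofReal q) (Nb * ENNReal.ofReal (Real.exp (-t)))) +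
        ∫⁻ t in Ioi s0, min (ENNReal.ofReal q) (Nb * ENNReal.ofReal (Real.exp (-t))) :=
        lintegral_union_le _ _ _
    _ ≤ (∫⁻ t in Ioc 0 s0, ENNReal.ofReal q) +
        ∫⁻ t in Ioi s0, Nb * ENNReal.ofReal (Real.exp (-t)) := by
        gcongr
        · exact min_le_left _ _
        · exact min_le_right _ _
    _ = _ := by
      congr 1
      · rw [lintegral_const, Measure.restrict_apply_univ, Real.volume_Ioc, ← ENNReal.ofReal_mul hq0,
          sub_zero, hs0, Real.negMulLog]
        congr 1; ring
      · rw [lintegral_const_mul _ (by fun_prop), ← ofReal_integral_eq_lintegral_ofReal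
          (integrableOn_exp_neg_Ioi s0) (ae_of_all _ fun t => (Real.exp_pos _).le),
          integral_exp_neg_Ioi, hs0, neg_neg, Real.exp_log h]

lemma GG_integrable (hP : Measurable fun x : L × (ℕ → ℕ) => P x.1 x.2) {R : ℝ}
    {r : ℕ → L × (ℕ → ℕ) → ℝ}
    (hr : ∀ n, Measurable (r n)) (hr0 : ∀ n x, 0 < r n x) (hrR : ∀ n x, r n x ≤ R)
    (hqs : Summable fun e => (ν (cyl e)).toReal)
    (hent : Summable fun e => Real.negMulLog (ν (cyl e)).toReal) :
    Integrable (GG ν P r) (m.prod ν) := by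
  obtain ⟨Nb, hNb⟩ := ps_max
  have hGm := GG_meas (ν := ν) hP hr
  refine ⟨hGm.aestronglyMeasurable, ?_⟩
  rw [hasFiniteIntegral_iff_ofReal (ae_of_all _ fun x => GG_nonneg r x)]
  set C : ℕ → Set (L × (ℕ → ℕ)) := fun e => {x | x.2 ∈ cyl e} with hC
  have hCm : ∀ e, MeasurableSet (C e) := fun e => measurable_snd (cyl_meas e)
  have hCu : (⋃ e, C e) = univ := by
    ext x; simp only [mem_iUnion, mem_univ, iff_true]; exact ⟨x.2 0, rfl⟩
  have hq1 : ∀ e, (ν (cyl e)).toReal ≤ 1 := fun e => by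
    have := ENNReal.toReal_mono ENNReal.one_ne_top (prob_le_one (μ := ν) (s := cyl e))
    simpa using this
  have hCq : ∀ e, (m.prod ν) (C e) = ν (cyl e) := by
    intro e
    have : C e = univ ×ˢ cyl e := by ext x; simp [hC]
    rw [this, Measure.prod_prod, measure_univ, one_mul]
  calc ∫⁻ x, ENNReal.ofReal (GG ν P r x) ∂(m.prod ν)
      = ∫⁻ x in ⋃ e, C e, ENNReal.ofReal (GG ν P r x) ∂(m.prod ν) := by
        rw [hCu, Measure.restrict_univ]
    _ ≤ ∑' e, ∫⁻ x in C e, ENNReal.ofReal (GG ν P r x) ∂(m.prod ν) := lintegral_iUnion_le _ _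
    _ ≤ ∑' e, (ENNReal.ofReal (Real.negMulLog (ν (cyl e)).toReal) +
          Nb * ENNReal.ofReal (ν (cyl e)).toReal) := by
        refine ENNReal.tsum_le_tsum fun e => ?_
        refine le_trans ?_ (layer_bound _ ENNReal.toReal_nonneg (hq1 e) Nb)
        rw [lintegral_eq_lintegral_meas_lt _ (ae_of_all _ fun x => GG_nonneg r x) hGm.aemeasurable]
        refine lintegral_mono_ae ((ae_restrict_iff' measurableSet_Ioi).2 (ae_of_all _ fun t ht => ?_))
        rw [Measure.restrict_apply (measurableSet_lt measurable_const hGm)]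
        refine le_min ?_ ?_
        · rw [ENNReal.ofReal_toReal (measure_ne_top _ _), ← hCq]
          exact measure_mono inter_subset_right
        · refine le_trans (measure_mono ?_) (hNb L m ν P hP R r hr hr0 hrR e _)
          rintro x ⟨h1, h2⟩
          refine ⟨h2, ?_⟩
          have h1' : t < - Real.log (ps ν P r x).toReal := h1
          have hfin : ps ν P r x ≠ ⊤ := ((ps_le_one r x).trans_lt ENNReal.one_lt_top).ne
          rw [← ENNReal.ofReal_toReal hfin]
          refine (ENNReal.ofReal_lt_ofReal_iff (Real.exp_pos _)).2 ?_
          rcases (ENNReal.toReal_nonneg (a := ps ν P r x)).eq_or_lt with h0 | h0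
          · rw [← h0]; exact Real.exp_pos _
          · rw [← Real.log_lt_iff_lt_exp h0]; linarith
    _ < ⊤ := by
        rw [ENNReal.tsum_add, ENNReal.tsum_mul_left]
        refine ENNReal.add_lt_top.2 ⟨hent.tsum_ofReal_lt_top, ENNReal.mul_lt_top (by simp)
          hqs.tsum_ofReal_lt_top⟩

end MaximalInt
end KSAux

namespace KSAux

section Diff

variable {L : Type} [MeasurableSpace L] {m : Measure L} [IsProbabilityMeasure m]
  {ν : Measure (ℕ → ℕ)} [IsProbabilityMeasure ν] {P : L → (ℕ → ℕ) → ℝ}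

/-- image kernel -/
def kk (ν : Measure (ℕ → ℕ)) [IsFiniteMeasure ν]
    (hP : Measurable fun x : L × (ℕ → ℕ) => P x.1 x.2) : ProbabilityTheory.Kernel L ℝ where
  toFun l := ν.map (P l)
  measurable' := by
    refine Measure.measurable_of_measurable_coe _ fun s hs => ?_
    have : (fun l => ν.map (P l) s) = fun l => ν (Prod.mk l ⁻¹' ((fun x : L × (ℕ → ℕ) => P x.1 x.2) ⁻¹' s)) := by
      ext l
      rw [Measure.map_apply (P_meas hP l) hs]
      rfl
    rw [this]
    exact measurable_measure_prodMk_left (hP hs)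

lemma kk_apply (ν : Measure (ℕ → ℕ)) [IsFiniteMeasure ν]
    (hP : Measurable fun x : L × (ℕ → ℕ) => P x.1 x.2) (l : L) : kk ν hP l = ν.map (P l) := rfl

instance (ν : Measure (ℕ → ℕ)) [IsFiniteMeasure ν]
    (hP : Measurable fun x : L × (ℕ → ℕ) => P x.1 x.2) :
    ProbabilityTheory.IsFiniteKernel (kk ν hP) :=
  ⟨⟨ν univ, measure_lt_top _ _, fun l => by
    rw [kk_apply, Measure.map_apply (P_meas hP l) MeasurableSet.univ, preimage_univ]⟩⟩

/-- the density -/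
def DE (ν : Measure (ℕ → ℕ)) [IsFiniteMeasure ν]
    (hP : Measurable fun x : L × (ℕ → ℕ) => P x.1 x.2) (e : ℕ) (z : L × ℝ) : ℝ≥0∞ :=
  ProbabilityTheory.Kernel.rnDeriv (kk (ν.restrict (cyl e)) hP) (kk ν hP) z.1 z.2

lemma DE_meas (hP : Measurable fun x : L × (ℕ → ℕ) => P x.1 x.2) (e : ℕ) :
    Measurable (DE ν hP e) :=
  ProbabilityTheory.Kernel.measurable_rnDeriv _ _

lemma ae_prod_of {Q : L × (ℕ → ℕ) → Prop} (hQ : MeasurableSet {x | Q x})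
    (h : ∀ l, ∀ᵐ ω ∂ν, Q (l, ω)) : ∀ᵐ x ∂(m.prod ν), Q x := by
  rw [Measure.ae_prod_iff_ae_ae hQ]
  exact ae_of_all _ h

lemma DE_lt_top (hP : Measurable fun x : L × (ℕ → ℕ) => P x.1 x.2) (e : ℕ) :
    ∀ᵐ x ∂(m.prod ν), DE ν hP e (x.1, P x.1 x.2) ≠ ⊤ := by
  refine ae_prod_of ?_ fun l => ?_
  · exact (measurableSet_eq_fun ((DE_meas hP e).comp (measurable_fst.prodMk hP))
      measurable_const).compl
  · have := ProbabilityTheory.Kernel.rnDeriv_ne_top (kk (ν.restrict (cyl e)) hP) (kk ν hP) (a := l)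
    exact ae_of_ae_map (P_meas hP l).aemeasurable this

lemma ratio_tendsto (hP : Measurable fun x : L × (ℕ → ℕ) => P x.1 x.2)
    {r : ℕ → L × (ℕ → ℕ) → ℝ}
    (hr : ∀ n, Measurable (r n)) (hr0 : ∀ n x, 0 < r n x)
    (hrl : ∀ x, Tendsto (fun n => r n x) atTop (𝓝 0)) (e : ℕ) :
    ∀ᵐ x ∂(m.prod ν), Tendsto (fun n => (NE ν P e x (r n x) / NN ν P x (r n x)).toReal) atTop
      (𝓝 (DE ν hP e (x.1, P x.1 x.2)).toReal) := by
  refine ae_prod_of ?_ fun l => ?_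
  · exact measurableSet_tendsto_fun
      (fun n => ((NE_meas hP (hr n) e).div (NN_meas hP (hr n))).ennreal_toReal)
      ((DE_meas hP e).comp (measurable_fst.prodMk hP)).ennreal_toReal
  · have hPl := P_meas hP l
    have h1 := Besicovitch.ae_tendsto_rnDeriv (kk (ν.restrict (cyl e)) hP l) (kk ν hP l)
    have h2 := ProbabilityTheory.Kernel.rnDeriv_eq_rnDeriv_measure
      (κ := kk (ν.restrict (cyl e)) hP) (η := kk ν hP) (a := l)
    have h3 := ProbabilityTheory.Kernel.rnDeriv_ne_top (kk (ν.restrict (cyl e)) hP) (kk ν hP) (a := l)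
    filter_upwards [ae_of_ae_map hPl.aemeasurable h1, ae_of_ae_map hPl.aemeasurable h2,
      ae_of_ae_map hPl.aemeasurable h3] with ω h1 h2 h3
    have hr' : Tendsto (fun n => r n (l, ω)) atTop (𝓝[>] 0) :=
      tendsto_nhdsWithin_iff.2 ⟨hrl _, Eventually.of_forall fun n => hr0 n _⟩
    have h4 := h1.comp hr'
    rw [← h2] at h4
    have h5 := (ENNReal.tendsto_toReal h3).comp h4
    refine h5.congr fun n => ?_
    simp only [comp_apply, kk_apply]
    rw [Measure.map_apply hPl measurableSet_closedBall,
        Measure.map_apply hPl measurableSet_closedBall,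
        Measure.restrict_apply (hPl measurableSet_closedBall), inter_comm]
    rfl

lemma DE_setLIntegral (hP : Measurable fun x : L × (ℕ → ℕ) => P x.1 x.2) (e : ℕ)
    {B : Set (L × ℝ)} (hB : MeasurableSet B) :
    ∫⁻ x in (fun x : L × (ℕ → ℕ) => (x.1, P x.1 x.2)) ⁻¹' B, DE ν hP e (x.1, P x.1 x.2) ∂(m.prod ν) =
      (m.prod ν) ((Prod.snd ⁻¹' cyl e) ∩ (fun x : L × (ℕ → ℕ) => (x.1, P x.1 x.2)) ⁻¹' B) := by
  have hj : Measurable fun x : L × (ℕ → ℕ) => (x.1, P x.1 x.2) := measurable_fst.prodMk hP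
  have hs := hj hB
  have hDm : Measurable fun x : L × (ℕ → ℕ) => DE ν hP e (x.1, P x.1 x.2) := (DE_meas hP e).comp hj
  rw [← lintegral_indicator hs, lintegral_prod _ ((hDm.indicator hs).aemeasurable),
    Measure.prod_apply ((measurable_snd (cyl_meas e)).inter hs)]
  refine lintegral_congr fun l => ?_
  have hPl := P_meas hP l
  have hBl : MeasurableSet (Prod.mk l ⁻¹' B) := measurable_prodMk_left hB
  have hac : kk (ν.restrict (cyl e)) hP l ≪ kk ν hP l :=
    (Measure.absolutelyContinuous_of_le Measure.restrict_le_self).map hPl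
  have h1 := ProbabilityTheory.Kernel.setLIntegral_rnDeriv hac hBl
  have h2 : ∫⁻ ω, indicator ((fun x : L × (ℕ → ℕ) => (x.1, P x.1 x.2)) ⁻¹' B)
      (fun x => DE ν hP e (x.1, P x.1 x.2)) (l, ω) ∂ν = ∫⁻ ω in P l ⁻¹' (Prod.mk l ⁻¹' B),
        ProbabilityTheory.Kernel.rnDeriv (kk (ν.restrict (cyl e)) hP) (kk ν hP) l (P l ω) ∂ν := by
    rw [← lintegral_indicator (hPl hBl)]
    rfl
  rw [h2, ← setLIntegral_map hBl (ProbabilityTheory.Kernel.measurable_rnDeriv_right _ _ _) hPl]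
  rw [← kk_apply ν hP, h1, kk_apply, Measure.map_apply hPl hBl, Measure.restrict_apply (hPl hBl),
    inter_comm]
  rfl

lemma condExp_eq (hP : Measurable fun x : L × (ℕ → ℕ) => P x.1 x.2) (e : ℕ) :
    (m.prod ν)[Set.indicator (Prod.snd ⁻¹' cyl e) (fun _ => (1 : ℝ)) | algLpi P] =ᵐ[m.prod ν]
      fun x => (DE ν hP e (x.1, P x.1 x.2)).toReal := by
  have hj : Measurable fun x : L × (ℕ → ℕ) => (x.1, P x.1 x.2) := measurable_fst.prodMk hP
  have hle : algLpi P ≤ (inferInstance : MeasurableSpace (L × (ℕ → ℕ))) := hj.comap_le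
  have hDm : Measurable fun x : L × (ℕ → ℕ) => DE ν hP e (x.1, P x.1 x.2) := (DE_meas hP e).comp hj
  have hcm : MeasurableSet (Prod.snd ⁻¹' cyl e : Set (L × (ℕ → ℕ))) := measurable_snd (cyl_meas e)
  have hint : Integrable (fun x : L × (ℕ → ℕ) => (DE ν hP e (x.1, P x.1 x.2)).toReal) (m.prod ν) := by
    refine integrable_toReal_of_lintegral_ne_top hDm.aemeasurable ?_
    have := DE_setLIntegral (m := m) (ν := ν) hP e MeasurableSet.univ
    rw [preimage_univ, Measure.restrict_univ] at this
    rw [this]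
    exact measure_ne_top _ _
  symm
  refine ae_eq_condExp_of_forall_setIntegral_eq hle
    ((integrable_const (1 : ℝ)).indicator hcm) (fun s _ _ => hint.integrableOn) ?_ ?_
  · rintro s ⟨B, hB, rfl⟩ _
    rw [integral_toReal hDm.aemeasurable.restrict
      (ae_restrict_of_ae ((DE_lt_top hP e).mono fun x hx => hx.lt_top)), DE_setLIntegral hP e hB,
      setIntegral_indicator hcm, setIntegral_const, smul_eq_mul, mul_one, inter_comm]
    rfl
  · have : Measurable[algLpi P] fun x : L × (ℕ → ℕ) => (DE ν hP e (x.1, P x.1 x.2)).toReal := by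
      have h1 : Measurable[algLpi P] fun x : L × (ℕ → ℕ) => (x.1, P x.1 x.2) :=
        comap_measurable _
      exact (DE_meas hP e).ennreal_toReal.comp h1
    exact this.stronglyMeasurable.aestronglyMeasurable

/-- measurable version of the information function -/
def ff (ν : Measure (ℕ → ℕ)) [IsFiniteMeasure ν]
    (hP : Measurable fun x : L × (ℕ → ℕ) => P x.1 x.2) (x : L × (ℕ → ℕ)) : ℝ :=
  - Real.log (DE ν hP (x.2 0) (x.1, P x.1 x.2)).toReal

lemma ff_meas (hP : Measurable fun x : L × (ℕ → ℕ) => P x.1 x.2) : Measurable (ff ν hP) :=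
  (Real.measurable_log.comp (meas_lab (F := fun e x => (DE ν hP e (x.1, P x.1 x.2)).toReal)
    fun e => ((DE_meas hP e).comp (measurable_fst.prodMk hP)).ennreal_toReal)).neg

lemma ff_eq (hP : Measurable fun x : L × (ℕ → ℕ) => P x.1 x.2) :
    condInfoCyl (m.prod ν) (algLpi P) =ᵐ[m.prod ν] ff ν hP := by
  filter_upwards [ae_all_iff.2 fun e => condExp_eq (m := m) (ν := ν) hP e] with x hx
  rw [condInfoCyl, ff, hx]

lemma condEnt_eq (hP : Measurable fun x : L × (ℕ → ℕ) => P x.1 x.2) :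
    condEntCyl (m.prod ν) (algLpi P) = ∫ x, ff ν hP x ∂(m.prod ν) :=
  integral_congr_ae (ff_eq hP)

/-- the approximate information functions -/
def gg (ν : Measure (ℕ → ℕ)) (P : L → (ℕ → ℕ) → ℝ) (r : ℕ → L × (ℕ → ℕ) → ℝ) (n : ℕ)
    (x : L × (ℕ → ℕ)) : ℝ := - Real.log (NC ν P x (r n x) / NN ν P x (r n x)).toReal

lemma gg_meas (hP : Measurable fun x : L × (ℕ → ℕ) => P x.1 x.2) {r : ℕ → L × (ℕ → ℕ) → ℝ}
    (hr : ∀ n, Measurable (r n)) (n : ℕ) : Measurable (gg ν P r n) :=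
  (Real.measurable_log.comp
    ((NC_meas hP (hr n)).div (NN_meas hP (hr n))).ennreal_toReal).neg

lemma ratio_le_one (x : L × (ℕ → ℕ)) (r : ℝ) : NC ν P x r / NN ν P x r ≤ 1 :=
  ENNReal.div_le_of_le_mul (by rw [one_mul]; exact NE_le _ _ _)

lemma gg_nonneg (r : ℕ → L × (ℕ → ℕ) → ℝ) (n : ℕ) (x : L × (ℕ → ℕ)) : 0 ≤ gg ν P r n x := by
  have : (NC ν P x (r n x) / NN ν P x (r n x)).toReal ≤ 1 := by
    have := ENNReal.toReal_mono ENNReal.one_ne_top (ratio_le_one (ν := ν) (P := P) x (r n x))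
    simpa using this
  exact neg_nonneg.2 (Real.log_nonpos ENNReal.toReal_nonneg this)

lemma ps_le_ratio (r : ℕ → L × (ℕ → ℕ) → ℝ) (n : ℕ) (x : L × (ℕ → ℕ)) :
    (ps ν P r x).toReal ≤ (NC ν P x (r n x) / NN ν P x (r n x)).toReal :=
  ENNReal.toReal_mono ((ratio_le_one x _).trans_lt ENNReal.one_lt_top).ne (iInf_le _ n)

lemma gg_le (r : ℕ → L × (ℕ → ℕ) → ℝ) (x : L × (ℕ → ℕ)) (hx : ps ν P r x ≠ 0) (n : ℕ) :
    |gg ν P r n x| ≤ GG ν P r x := by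
  rw [abs_of_nonneg (gg_nonneg r n x)]
  refine neg_le_neg (Real.log_le_log ?_ (ps_le_ratio r n x))
  exact ENNReal.toReal_pos hx ((ps_le_one r x).trans_lt ENNReal.one_lt_top).ne

lemma gg_tendsto (hP : Measurable fun x : L × (ℕ → ℕ) => P x.1 x.2) {R : ℝ}
    {r : ℕ → L × (ℕ → ℕ) → ℝ}
    (hr : ∀ n, Measurable (r n)) (hr0 : ∀ n x, 0 < r n x) (hrR : ∀ n x, r n x ≤ R)
    (hrl : ∀ x, Tendsto (fun n => r n x) atTop (𝓝 0)) :
    ∀ᵐ x ∂(m.prod ν), Tendsto (fun n => gg ν P r n x) atTop (𝓝 (ff ν hP x)) := by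
  filter_upwards [ae_all_iff.2 fun e => ratio_tendsto (m := m) (ν := ν) hP hr hr0 hrl e,
    ps_ne_zero (m := m) (ν := ν) hP hr hr0 hrR] with x h1 h2
  have h3 := h1 (x.2 0)
  have hpos : 0 < (ps ν P r x).toReal :=
    ENNReal.toReal_pos h2 ((ps_le_one r x).trans_lt ENNReal.one_lt_top).ne
  have h4 : (ps ν P r x).toReal ≤ (DE ν hP (x.2 0) (x.1, P x.1 x.2)).toReal :=
    ge_of_tendsto' h3 fun n => ps_le_ratio r n x
  exact ((Real.continuousAt_log (hpos.trans_le h4).ne').tendsto.comp h3).neg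

/-- nonnegativity of conditional entropy -/
lemma condEnt_nonneg (μ : Measure (L × (ℕ → ℕ))) [IsProbabilityMeasure μ]
    (𝔪 : MeasurableSpace (L × (ℕ → ℕ))) (h𝔪 : 𝔪 ≤ Prod.instMeasurableSpace) : 0 ≤ condEntCyl μ 𝔪 := by
  have h : ∀ e : ℕ, ∀ᵐ x ∂μ,
      0 ≤ (μ[Set.indicator (Prod.snd ⁻¹' cyl e) (fun _ => (1 : ℝ)) | 𝔪]) x ∧
      (μ[Set.indicator (Prod.snd ⁻¹' cyl e) (fun _ => (1 : ℝ)) | 𝔪]) x ≤ 1 := by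
    intro e
    have hi : Integrable (Set.indicator (Prod.snd ⁻¹' cyl e) (fun _ => (1 : ℝ))) μ :=
      (integrable_const (1 : ℝ)).indicator (measurable_snd (cyl_meas e))
    have h1 := condExp_mono (m := 𝔪) (integrable_const (0 : ℝ)) hi
      (ae_of_all _ fun x => indicator_nonneg (fun _ _ => zero_le_one) x)
    have h2 := condExp_mono (m := 𝔪) hi (integrable_const (1 : ℝ))
      (ae_of_all _ fun x => indicator_le_self' (fun _ _ => zero_le_one) x)
    rw [condExp_const h𝔪] at h1 h2
    filter_upwards [h1, h2] with x h1 h2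
    exact ⟨h1, h2⟩
  refine integral_nonneg_of_ae ?_
  filter_upwards [ae_all_iff.2 h] with x hx
  exact neg_nonneg.2 (Real.log_nonpos (hx _).1 (hx _).2)

end Diff
end KSAux

namespace KSAux

section Interp

lemma interp {b R : ℕ → ℝ} {M : ℝ → ℝ} {h c : ℝ} (hR0 : ∀ n, 0 < R n)
    (hRl : Tendsto R atTop (𝓝 0)) (hanti : Antitone R)
    (hM : ∀ n r, R (n + 1) < r → r ≤ R n → b (n + 1) ≤ M r ∧ M r ≤ b n) (hb0 : ∀ n, b n ≤ 0)
    (hb : Tendsto (fun n : ℕ => b n / n) atTop (𝓝 (-h)))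
    (hc : Tendsto (fun n : ℕ => (n : ℝ) / (- Real.log (R n))) atTop (𝓝 c)) :
    Tendsto (fun r => M r / Real.log r) (𝓝[>] 0) (𝓝 (h * c)) := by
  have hq : Tendsto (fun n : ℕ => ((n : ℝ) + 1) / n) atTop (𝓝 1) := by
    have h1 : Tendsto (fun n : ℕ => 1 + 1 / (n : ℝ)) atTop (𝓝 (1 + 0)) :=
      tendsto_const_nhds.add tendsto_one_div_atTop_nhds_zero_nat
    rw [add_zero] at h1
    refine h1.congr' ?_
    filter_upwards [eventually_gt_atTop 0] with n hn
    have : (n : ℝ) ≠ 0 := by positivity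
    field_simp
  have hlo : Tendsto (fun n : ℕ => (- b n) / (- Real.log (R (n + 1)))) atTop (𝓝 (h * c)) := by
    have h1 := hc.comp (tendsto_add_atTop_nat 1)
    have h2 := (hb.neg.mul (hq.inv₀ one_ne_zero)).mul h1
    rw [neg_neg, inv_one, mul_one] at h2
    refine h2.congr' ?_
    filter_upwards [eventually_gt_atTop 0] with n hn
    have : (n : ℝ) ≠ 0 := by positivity
    have : (n : ℝ) + 1 ≠ 0 := by positivity
    simp only [comp_apply, Nat.cast_add, Nat.cast_one]
    field_simp
  have hhi : Tendsto (fun n : ℕ => (- b (n + 1)) / (- Real.log (R n))) atTop (𝓝 (h * c)) := by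
    have h1 := (hb.comp (tendsto_add_atTop_nat 1)).neg
    have h2 := (h1.mul hq).mul hc
    rw [neg_neg, mul_one] at h2
    refine h2.congr' ?_
    filter_upwards [eventually_gt_atTop 0] with n hn
    have : (n : ℝ) ≠ 0 := by positivity
    have : (n : ℝ) + 1 ≠ 0 := by positivity
    simp only [comp_apply, Nat.cast_add, Nat.cast_one]
    field_simp
  rw [Metric.tendsto_nhds]
  intro ε hε
  have h1 := (Metric.tendsto_nhds.1 hlo ε hε).and ((Metric.tendsto_nhds.1 hhi ε hε).and
    (hRl.eventually (gt_mem_nhds (zero_lt_one' ℝ))))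
  obtain ⟨n0, hn0⟩ := eventually_atTop.1 h1
  have h2 : ∀ᶠ r : ℝ in 𝓝[>] 0, 0 < r ∧ r < R n0 :=
    (eventually_mem_nhdsWithin).and (nhdsWithin_le_nhds (gt_mem_nhds (hR0 n0)))
  filter_upwards [h2] with r hr
  have hex : ∃ k, R k < r := (hRl.eventually (gt_mem_nhds hr.1)).exists
  classical
  set k := Nat.find hex with hk
  have hkr : R k < r := Nat.find_spec hex
  have hkn : n0 < k := by
    by_contra hcon
    have := hanti (not_lt.1 hcon)
    linarith [hr.2]
  obtain ⟨n, hn⟩ : ∃ n, k = n + 1 := ⟨k - 1, by omega⟩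
  have hnr : r ≤ R n := not_lt.1 (Nat.find_min hex (show n < Nat.find hex by omega))
  rw [hn] at hkr
  obtain ⟨a1, a2, a3⟩ := hn0 n (by omega)
  obtain ⟨m1, m2⟩ := hM n r hkr hnr
  have l1 : 0 < - Real.log (R n) := neg_pos.2 (Real.log_neg (hR0 n) a3)
  have l2 : - Real.log (R n) ≤ - Real.log r := neg_le_neg (Real.log_le_log hr.1 hnr)
  have l3 : - Real.log r ≤ - Real.log (R (n + 1)) :=
    neg_le_neg (Real.log_le_log (hR0 _) hkr.le)
  have e : M r / Real.log r = (- M r) / (- Real.log r) := by rw [neg_div_neg_eq]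
  have u1 : (- b n) / (- Real.log (R (n + 1))) ≤ (- M r) / (- Real.log r) :=
    div_le_div₀ (by linarith [hb0 n]) (by linarith) (by linarith) l3
  have u2 : (- M r) / (- Real.log r) ≤ (- b (n + 1)) / (- Real.log (R n)) :=
    div_le_div₀ (by linarith [hb0 (n+1)]) (by linarith) l1 l2
  rw [e]
  rw [Real.dist_eq, abs_lt] at a1 a2 ⊢
  constructor <;> linarith [a1.1, a2.2]

end Interp

section Main

variable {ρ : ℕ → ℝ} {ρbar : ℝ}

/-- the radii -/
def rr (ρ : ℕ → ℝ) (ρbar : ℝ) (n : ℕ) (x : (ℤ → ℕ) × (ℕ → ℕ)) : ℝ := 2 / (1 - ρbar) * RR ρ n x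

variable (hρ : ∀ i, ρ i ∈ Set.Ioo (0 : ℝ) 1)
    (hρbar : ρbar ∈ Set.Ioo (0 : ℝ) 1) (hρle : ∀ i, ρ i ≤ ρbar)

lemma rr_meas (n : ℕ) : Measurable (rr ρ ρbar n) := (RR_meas ρ n).const_mul _

include hρ hρbar hρle

lemma CC_pos : 0 < 2 / (1 - ρbar) := div_pos two_pos (sub_pos.2 hρbar.2)

lemma rr_pos (n : ℕ) (x : (ℤ → ℕ) × (ℕ → ℕ)) : 0 < rr ρ ρbar n x :=
  mul_pos (CC_pos hρ hρbar hρle) (RR_pos hρ hρbar hρle n x)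

lemma rr_le (n : ℕ) (x : (ℤ → ℕ) × (ℕ → ℕ)) : rr ρ ρbar n x ≤ 2 / (1 - ρbar) * ρbar ^ n :=
  mul_le_mul_of_nonneg_left (RR_le hρ hρbar hρle n x) (CC_pos hρ hρbar hρle).le

lemma rr_le' (n : ℕ) (x : (ℤ → ℕ) × (ℕ → ℕ)) : rr ρ ρbar n x ≤ 2 / (1 - ρbar) :=
  (rr_le hρ hρbar hρle n x).trans
    (mul_le_of_le_one_right (CC_pos hρ hρbar hρle).le (pow_le_one₀ hρbar.1.le hρbar.2.le))

lemma rr_tendsto (x : (ℤ → ℕ) × (ℕ → ℕ)) : Tendsto (fun n => rr ρ ρbar n x) atTop (𝓝 0) := by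
  have h1 : Tendsto (fun n : ℕ => 2 / (1 - ρbar) * ρbar ^ n) atTop (𝓝 (2 / (1 - ρbar) * 0)) :=
    (tendsto_pow_atTop_nhds_zero_of_lt_one hρbar.1.le hρbar.2).const_mul _
  rw [mul_zero] at h1
  exact squeeze_zero (fun n => (rr_pos hρ hρbar hρle n x).le)
    (fun n => rr_le hρ hρbar hρle n x) h1

lemma rr_anti (x : (ℤ → ℕ) × (ℕ → ℕ)) : Antitone fun n => rr ρ ρbar n x := by
  refine antitone_nat_of_succ_le fun n => ?_
  refine mul_le_mul_of_nonneg_left ?_ (CC_pos hρ hρbar hρle).le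
  rw [RR, Finset.prod_range_succ]
  exact mul_le_of_le_one_right (RR_pos hρ hρbar hρle n x).le (hρ _).2.le

variable {q : ℕ → ℝ} [IsProbabilityMeasure (pm q)]

lemma NN_zero (ν : Measure (ℕ → ℕ)) [IsProbabilityMeasure ν] (x : (ℤ → ℕ) × (ℕ → ℕ)) :
    NN ν (KahaneSalem.π ρ) x (rr ρ ρbar 0 x) = 1 := by
  have : BB (KahaneSalem.π ρ) x (rr ρ ρbar 0 x) = univ := by
    refine eq_univ_of_forall fun ω => ?_
    change dist _ _ ≤ _
    rw [Real.dist_eq]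
    refine (abs_sub _ _).trans ?_
    have h1 := pi_bd hρ hρbar hρle (x.1, ω)
    have h2 := pi_bd hρ hρbar hρle x
    have : rr ρ ρbar 0 x = 1 / (1 - ρbar) + 1 / (1 - ρbar) := by simp [rr, RR]; ring
    rw [this]
    exact add_le_add h1 h2
  rw [NN, this, measure_univ]

lemma NC_succ (n : ℕ) (x : (ℤ → ℕ) × (ℕ → ℕ)) :
    NC (Measure.infinitePi fun _ : ℕ => pm q) (KahaneSalem.π ρ) x (rr ρ ρbar (n + 1) x) =
      ENNReal.ofReal (q (x.2 0)) * NN (Measure.infinitePi fun _ : ℕ => pm q) (KahaneSalem.π ρ)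
        (TT x) (rr ρ ρbar n (TT x)) := by
  have hm : MeasurableSet (BB (KahaneSalem.π ρ) (TT x) (rr ρ ρbar n (TT x))) :=
    P_meas (pi_meas hρ hρbar hρle) _ measurableSet_closedBall
  rw [NC, NE, NN, ← pm_apply_nu_shift _ hm]
  congr 1
  ext ω
  simp only [mem_inter_iff, mem_preimage, BB, mem_closedBall, Real.dist_eq]
  refine and_congr_right fun hω => ?_
  have hω' : ω 0 = x.2 0 := hω
  have h1 := pi_rec hρ hρbar hρle (x.1, ω)
  have h2 := pi_rec hρ hρbar hρle x
  have hd : dd ρ (x.1, ω) = dd ρ x := by simp [dd, ix, hω']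
  simp only [hd] at h1
  have hT : (TT (x.1, ω)) = ((TT x).1, RIFS.shift ω) := rfl
  rw [hT] at h1
  simp only at h1
  have hpos : 0 < dd ρ x := (hρ _).1
  rw [h1, h2, add_sub_add_right_eq_sub, ← mul_sub, abs_mul, abs_of_pos hpos]
  have hr : rr ρ ρbar (n + 1) x = dd ρ x * rr ρ ρbar n (TT x) := by
    simp only [rr, RR_succ]; ring
  rw [hr, mul_le_mul_iff_right₀ hpos]

lemma NN_pos (n : ℕ) : ∀ x : (ℤ → ℕ) × (ℕ → ℕ), (∀ k, 0 < q (x.2 k)) →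
    NN (Measure.infinitePi fun _ : ℕ => pm q) (KahaneSalem.π ρ) x (rr ρ ρbar n x) ≠ 0 := by
  induction n with
  | zero => intro x _; rw [NN_zero hρ hρbar hρle]; exact one_ne_zero
  | succ n ih =>
    intro x hx
    have h1 := NE_le (ν := Measure.infinitePi fun _ : ℕ => pm q) (P := KahaneSalem.π ρ)
      (x.2 0) x (rr ρ ρbar (n + 1) x)
    have h2 := NC_succ hρ hρbar hρle (q := q) n x
    rw [NC] at h2
    rw [h2] at h1
    have h3 := ih (TT x) (fun k => hx (k + 1))
    intro h0
    rw [h0, nonpos_iff_eq_zero, mul_eq_zero] at h1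
    rcases h1 with h1 | h1
    · exact absurd (ENNReal.ofReal_eq_zero.1 h1) (not_le.2 (hx 0))
    · exact h3 h1

lemma logNN (n : ℕ) : ∀ x : (ℤ → ℕ) × (ℕ → ℕ), (∀ k, 0 < q (x.2 k)) →
    Real.log (NN (Measure.infinitePi fun _ : ℕ => pm q) (KahaneSalem.π ρ) x (rr ρ ρbar n x)).toReal =
      birkhoffSum TT (fun x => Real.log (q (x.2 0))) n x +
      ∑ k ∈ Finset.range n, gg (Measure.infinitePi fun _ : ℕ => pm q) (KahaneSalem.π ρ) (rr ρ ρbar)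
        (n - k) (TT^[k] x) := by
  induction n with
  | zero => intro x _; rw [NN_zero hρ hρbar hρle]; simp
  | succ n ih =>
    intro x hx
    have hx' : ∀ k, 0 < q ((TT x).2 k) := fun k => hx (k + 1)
    have h3 := ih (TT x) hx'
    rw [birkhoffSum_succ', Finset.sum_range_succ']
    simp only [iterate_succ_apply, Nat.add_sub_add_right, iterate_zero, id, Nat.sub_zero]
    set ν := Measure.infinitePi fun _ : ℕ => pm q with hν
    have hA := NN_pos hρ hρbar hρle (q := q) (n + 1) x hx
    have hB := NN_pos hρ hρbar hρle (q := q) n (TT x) hx'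
    rw [← hν] at hA hB
    have hA' : 0 < (NN ν (KahaneSalem.π ρ) x (rr ρ ρbar (n + 1) x)).toReal :=
      ENNReal.toReal_pos hA (measure_ne_top _ _)
    have hB' : 0 < (NN ν (KahaneSalem.π ρ) (TT x) (rr ρ ρbar n (TT x))).toReal :=
      ENNReal.toReal_pos hB (measure_ne_top _ _)
    have hg : gg ν (KahaneSalem.π ρ) (rr ρ ρbar) (n + 1) x =
        - (Real.log (q (x.2 0)) + Real.log (NN ν (KahaneSalem.π ρ) (TT x) (rr ρ ρbar n (TT x))).toReal
          - Real.log (NN ν (KahaneSalem.π ρ) x (rr ρ ρbar (n + 1) x)).toReal) := by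
      rw [gg, NC_succ hρ hρbar hρle (q := q) n x, ENNReal.toReal_div, ENNReal.toReal_mul,
        ENNReal.toReal_ofReal (hx 0).le, Real.log_div (mul_pos (hx 0) hB').ne' hA'.ne',
        Real.log_mul (hx 0).ne' hB'.ne']
    rw [hg, h3]
    ring

end Main

section Limits

variable {p q : ℕ → ℝ} [IsProbabilityMeasure (pm p)] [IsProbabilityMeasure (pm q)]

lemma nu_cyl (e : ℕ) : (Measure.infinitePi fun _ : ℕ => pm q) (cyl e) = ENNReal.ofReal (q e) := by
  have := pm_apply_nu_shift (q := q) e MeasurableSet.univ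
  rwa [preimage_univ, inter_univ, measure_univ, mul_one] at this

lemma nu_shift {B : Set (ℕ → ℕ)} (hB : MeasurableSet B) :
    (Measure.infinitePi fun _ : ℕ => pm q) (RIFS.shift ⁻¹' B) =
      (Measure.infinitePi fun _ : ℕ => pm q) B := by
  have h := (TT_ergodic (p := q) (q := q)).toMeasurePreserving.measure_preimage
    ((MeasurableSet.univ (α := ℤ → ℕ)).prod hB).nullMeasurableSet
  have e : TT ⁻¹' ((univ : Set (ℤ → ℕ)) ×ˢ B) = (univ : Set (ℤ → ℕ)) ×ˢ (RIFS.shift ⁻¹' B) := by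
    ext x; simp [TT]
  rw [e, Measure.prod_prod, Measure.prod_prod, measure_univ, one_mul, one_mul] at h
  exact h

lemma ae_pos (hq0 : ∀ i, 0 ≤ q i) : ∀ᵐ x ∂((Measure.infinitePi fun _ : ℤ => pm p).prod
      (Measure.infinitePi fun _ : ℕ => pm q)), ∀ k, 0 < q (x.2 k) := by
  rw [ae_all_iff]
  intro k
  have h0 : ∀ᵐ j ∂(pm q), 0 < q j := by
    rw [ae_iff_of_countable]
    intro j hj
    rw [pm_singleton] at hj
    rcases (hq0 j).eq_or_lt with h | h
    · rw [← h] at hj; simp at hj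
    · exact h
  rw [← ev0_map (p := p) (q := q)] at h0
  have h1 := ae_of_ae_map ((measurable_pi_apply 0).comp measurable_snd).aemeasurable h0
  have h2 := ((TT_ergodic (p := p) (q := q)).toMeasurePreserving.iterate k).quasiMeasurePreserving.ae h1
  filter_upwards [h2] with x hx
  simpa [TT_iter_snd] using hx

lemma q_le_one (hq0 : ∀ i, 0 ≤ q i) (hq1 : ∑' i, q i = 1) (i : ℕ) : q i ≤ 1 := by
  rw [← hq1]
  exact (summable_of_tsum_one hq1).le_tsum i fun j _ => hq0 j

lemma logq_int (hq0 : ∀ i, 0 ≤ q i) (hq1 : ∑' i, q i = 1)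
    (hqent : Summable fun i => Real.negMulLog (q i)) :
    Integrable (fun x : (ℤ → ℕ) × (ℕ → ℕ) => Real.log (q (x.2 0)))
      ((Measure.infinitePi fun _ : ℤ => pm p).prod (Measure.infinitePi fun _ : ℕ => pm q)) := by
  have h : Integrable (fun j => Real.log (q j)) (pm q) := by
    rw [integrable_pm hq0]
    refine hqent.congr fun j => ?_
    rw [abs_of_nonpos (Real.log_nonpos (hq0 j) (q_le_one hq0 hq1 j)), Real.negMulLog]
    ring
  rw [← ev0_map (p := p) (q := q)] at h
  exact h.comp_measurable ((measurable_pi_apply 0).comp measurable_snd)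

lemma logq_integral (hq0 : ∀ i, 0 ≤ q i) :
    ∫ x, Real.log (q (x.2 0))
      ∂((Measure.infinitePi fun _ : ℤ => pm p).prod (Measure.infinitePi fun _ : ℕ => pm q)) =
      ∑' j, q j * Real.log (q j) := by
  have h := integral_map (μ := (Measure.infinitePi fun _ : ℤ => pm p).prod
      (Measure.infinitePi fun _ : ℕ => pm q)) (φ := fun x : (ℤ → ℕ) × (ℕ → ℕ) => x.2 0)
    ((measurable_pi_apply 0).comp measurable_snd).aemeasurable
    (f := fun j => Real.log (q j)) (measurable_of_countable _).aestronglyMeasurable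
  rw [ev0_map (p := p) (q := q), integral_pm hq0] at h
  exact h.symm

lemma condEntT {P : (ℤ → ℕ) → (ℕ → ℕ) → ℝ}
    (hP : Measurable fun x : (ℤ → ℕ) × (ℕ → ℕ) => P x.1 x.2) (hq0 : ∀ i, 0 ≤ q i) :
    condEntCyl ((Measure.infinitePi fun _ : ℤ => pm p).prod (Measure.infinitePi fun _ : ℕ => pm q))
      (algLpiT θz P) = - ∑' j, q j * Real.log (q j) := by
  set m := Measure.infinitePi fun _ : ℤ => pm p with hm
  set ν := Measure.infinitePi fun _ : ℕ => pm q with hν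
  have hj : Measurable fun x : (ℤ → ℕ) × (ℕ → ℕ) => (x.1, P (θz x.1) (RIFS.shift x.2)) :=
    measurable_fst.prodMk (hP.comp TT_meas)
  have hle : algLpiT θz P ≤ Prod.instMeasurableSpace := hj.comap_le
  have hce : ∀ e : ℕ, (m.prod ν)[Set.indicator (Prod.snd ⁻¹' cyl e) (fun _ => (1 : ℝ)) | algLpiT θz P]
      =ᵐ[m.prod ν] fun _ => q e := by
    intro e
    have hcm : MeasurableSet (Prod.snd ⁻¹' cyl e : Set ((ℤ → ℕ) × (ℕ → ℕ))) :=
      measurable_snd (cyl_meas e)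
    symm
    refine ae_eq_condExp_of_forall_setIntegral_eq hle
      ((integrable_const (1 : ℝ)).indicator hcm) (fun s _ _ => (integrable_const _).integrableOn) ?_
      stronglyMeasurable_const.aestronglyMeasurable
    rintro s ⟨B, hB, rfl⟩ _
    rw [setIntegral_const, setIntegral_indicator hcm, setIntegral_const, smul_eq_mul, smul_eq_mul,
      mul_one]
    set s := (fun x : (ℤ → ℕ) × (ℕ → ℕ) => (x.1, P (θz x.1) (RIFS.shift x.2))) ⁻¹' B with hs
    have hsm : MeasurableSet s := hj hB
    have hBl : ∀ l : ℤ → ℕ, MeasurableSet {ω : ℕ → ℕ | (l, P (θz l) ω) ∈ B} := fun l =>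
      (measurable_const.prodMk (P_meas hP (θz l))) hB
    have key : (m.prod ν) (s ∩ Prod.snd ⁻¹' cyl e) = ENNReal.ofReal (q e) * (m.prod ν) s := by
      rw [Measure.prod_apply (hsm.inter hcm), Measure.prod_apply hsm,
        ← lintegral_const_mul _ (measurable_measure_prodMk_left hsm)]
      refine lintegral_congr fun l => ?_
      have e1 : Prod.mk l ⁻¹' s = RIFS.shift ⁻¹' {ω : ℕ → ℕ | (l, P (θz l) ω) ∈ B} := rfl
      have e2 : Prod.mk l ⁻¹' (s ∩ Prod.snd ⁻¹' cyl e) =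
        cyl e ∩ RIFS.shift ⁻¹' {ω : ℕ → ℕ | (l, P (θz l) ω) ∈ B} := by
        rw [preimage_inter, e1, inter_comm]; rfl
      rw [e1, e2, hν, pm_apply_nu_shift e (hBl l), nu_shift (hBl l)]
    rw [measureReal_def, measureReal_def, key, ENNReal.toReal_mul, ENNReal.toReal_ofReal (hq0 e),
      mul_comm]
  rw [← logq_integral (p := p) hq0, ← integral_neg]
  refine integral_congr_ae ?_
  filter_upwards [ae_all_iff.2 hce] with x hx
  rw [condInfoCyl, hx]

variable {ρ : ℕ → ℝ} {ρbar : ℝ} (hρ : ∀ i, ρ i ∈ Set.Ioo (0 : ℝ) 1)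
    (hρbar : ρbar ∈ Set.Ioo (0 : ℝ) 1) (hρle : ∀ i, ρ i ≤ ρbar)

lemma lyap_eq (hp0 : ∀ i, 0 ≤ p i) :
    lyap θz (KahaneSalem.π ρ) (Dφ ρ)
      ((Measure.infinitePi fun _ : ℤ => pm p).prod (Measure.infinitePi fun _ : ℕ => pm q)) =
      - ∑' j, p j * Real.log (ρ j) := by
  have h := integral_map (μ := (Measure.infinitePi fun _ : ℤ => pm p).prod
      (Measure.infinitePi fun _ : ℕ => pm q)) ix_meas.aemeasurable
    (f := fun j => Real.log (ρ j)) (measurable_of_countable _).aestronglyMeasurable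
  rw [ix_map (p := p) (q := q), integral_pm hp0] at h
  exact congrArg Neg.neg h.symm

include hρ hρbar hρle

lemma logNN_tendsto (hq0 : ∀ i, 0 ≤ q i) (hq1 : ∑' i, q i = 1)
    (hqent : Summable fun i => Real.negMulLog (q i)) :
    ∀ᵐ x ∂((Measure.infinitePi fun _ : ℤ => pm p).prod (Measure.infinitePi fun _ : ℕ => pm q)),
      Tendsto (fun n : ℕ => Real.log (NN (Measure.infinitePi fun _ : ℕ => pm q) (KahaneSalem.π ρ) x
        (rr ρ ρbar n x)).toReal / n) atTop (𝓝 (- projEnt θz (KahaneSalem.π ρ)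
        ((Measure.infinitePi fun _ : ℤ => pm p).prod (Measure.infinitePi fun _ : ℕ => pm q)))) := by
  have hP := pi_meas hρ hρbar hρle
  have hcyl : ∀ e, ((Measure.infinitePi fun _ : ℕ => pm q) (cyl e)).toReal = q e := fun e => by
    rw [nu_cyl, ENNReal.toReal_ofReal (hq0 e)]
  have hr := rr_meas (ρ := ρ) (ρbar := ρbar)
  have hGi := GG_integrable (m := Measure.infinitePi fun _ : ℤ => pm p)
    (ν := Measure.infinitePi fun _ : ℕ => pm q) hP hr (rr_pos hρ hρbar hρle)
    (rr_le' hρ hρbar hρle) (by simpa only [hcyl] using summable_of_tsum_one hq1)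
    (by simpa only [hcyl] using hqent)
  have hgG : ∀ᵐ x ∂((Measure.infinitePi fun _ : ℤ => pm p).prod (Measure.infinitePi fun _ : ℕ => pm q)),
      ∀ n, |gg (Measure.infinitePi fun _ : ℕ => pm q) (KahaneSalem.π ρ) (rr ρ ρbar) n x| ≤
        GG (Measure.infinitePi fun _ : ℕ => pm q) (KahaneSalem.π ρ) (rr ρ ρbar) x :=
    (ps_ne_zero hP hr (rr_pos hρ hρbar hρle) (rr_le' hρ hρbar hρle)).mono fun x hx n =>
      gg_le _ x hx n
  have h1 := maker TT_ergodic (fun n => gg_meas hP hr n) (ff_meas hP) (GG_meas hP hr) hGi hgG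
    (gg_tendsto hP hr (rr_pos hρ hρbar hρle) (rr_le' hρ hρbar hρle) (rr_tendsto hρ hρbar hρle))
  have h2 := birkhoff (TT_ergodic (p := p) (q := q))
    (f := fun x => Real.log (q (x.2 0)))
    ((measurable_of_countable fun j => Real.log (q j)).comp
      ((measurable_pi_apply 0).comp measurable_snd)) (logq_int hq0 hq1 hqent)
  filter_upwards [h1, h2, ae_pos (p := p) hq0] with x h1 h2 h3
  have h4 := h2.add h1
  rw [projEnt, condEntT hP hq0, condEnt_eq hP, neg_sub, sub_neg_eq_add]
  rw [logq_integral hq0, add_comm (∑' j, q j * Real.log (q j))] at h4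
  refine h4.congr fun n => ?_
  rw [logNN hρ hρbar hρle n x h3, add_div]

lemma log_rr (n : ℕ) (x : (ℤ → ℕ) × (ℕ → ℕ)) : - Real.log (rr ρ ρbar n x) =
    - Real.log (2 / (1 - ρbar)) + birkhoffSum TT (fun x => - Real.log (dd ρ x)) n x := by
  rw [rr, Real.log_mul (CC_pos hρ hρbar hρle).ne' (RR_pos hρ hρbar hρle n x).ne', RR,
    Real.log_prod (fun k _ => (show dd ρ (TT^[k] x) ≠ 0 from (hρ _).1.ne')), birkhoffSum, Finset.sum_neg_distrib]
  ring

lemma nrr_tendsto :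
    ∀ᵐ x ∂((Measure.infinitePi fun _ : ℤ => pm p).prod (Measure.infinitePi fun _ : ℕ => pm q)),
      Tendsto (fun n : ℕ => (n : ℝ) / (- Real.log (rr ρ ρbar n x))) atTop
        (𝓝 (lyap θz (KahaneSalem.π ρ) (Dφ ρ)
      ((Measure.infinitePi fun _ : ℤ => pm p).prod (Measure.infinitePi fun _ : ℕ => pm q)))⁻¹) := by
  set μ := ((Measure.infinitePi fun _ : ℤ => pm p).prod (Measure.infinitePi fun _ : ℕ => pm q)) with hμ
  have hl : lyap θz (KahaneSalem.π ρ) (Dφ ρ) μ = ∫ x, - Real.log (dd ρ x) ∂μ := by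
    rw [integral_neg]; rfl
  have hdm : Measurable fun x => - Real.log (dd ρ x) := (Real.measurable_log.comp (dd_meas ρ)).neg
  have hge : ∀ x, - Real.log ρbar ≤ - Real.log (dd ρ x) := fun x =>
    neg_le_neg (Real.log_le_log (hρ _).1 (hρle _))
  have hb : 0 < - Real.log ρbar := neg_pos.2 (Real.log_neg hρbar.1 hρbar.2)
  have hconst : Tendsto (fun n : ℕ => - Real.log (2 / (1 - ρbar)) / n) atTop (𝓝 0) :=
    tendsto_const_div_atTop_nhds_zero_nat _
  have e : ∀ x (n : ℕ), (n : ℝ) / (- Real.log (rr ρ ρbar n x)) =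
      (- Real.log (2 / (1 - ρbar)) / n + birkhoffSum TT (fun x => - Real.log (dd ρ x)) n x / n)⁻¹ := by
    intro x n
    rw [log_rr hρ hρbar hρle, ← add_div, inv_div]
  simp only [e]
  by_cases hi : Integrable (fun x => - Real.log (dd ρ x)) μ
  · have hpos : 0 < lyap θz (KahaneSalem.π ρ) (Dφ ρ) μ := by
      rw [hl]
      have := integral_mono (integrable_const (- Real.log ρbar)) hi hge
      rw [integral_const, probReal_univ, one_smul] at this
      linarith
    filter_upwards [birkhoff TT_ergodic hdm hi] with x hx
    rw [← hl] at hx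
    have := (hconst.add hx).inv₀ (by rw [zero_add]; exact hpos.ne')
    rwa [zero_add] at this
  · rw [hl, integral_undef hi, inv_zero]
    filter_upwards [birkhoff_top TT_ergodic hdm (fun x => hb.le.trans (hge x)) hi] with x hx
    exact (hconst.add_atTop hx).inv_tendsto_atTop

lemma dim_tendsto (hq0 : ∀ i, 0 ≤ q i) (hq1 : ∑' i, q i = 1)
    (hqent : Summable fun i => Real.negMulLog (q i)) :
    ∀ᵐ x ∂((Measure.infinitePi fun _ : ℤ => pm p).prod (Measure.infinitePi fun _ : ℕ => pm q)),
      Tendsto (fun r : ℝ => Real.log (((Measure.infinitePi fun _ : ℕ => pm q).map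
            (KahaneSalem.π ρ x.1) (Metric.ball (KahaneSalem.π ρ x.1 x.2) r)).toReal) / Real.log r)
        (𝓝[>] 0)
        (𝓝 (projEnt θz (KahaneSalem.π ρ)
        ((Measure.infinitePi fun _ : ℤ => pm p).prod (Measure.infinitePi fun _ : ℕ => pm q)) /
          lyap θz (KahaneSalem.π ρ) (Dφ ρ)
          ((Measure.infinitePi fun _ : ℤ => pm p).prod (Measure.infinitePi fun _ : ℕ => pm q)))) := by
  filter_upwards [logNN_tendsto (p := p) hρ hρbar hρle hq0 hq1 hqent,
    nrr_tendsto (p := p) (q := q) hρ hρbar hρle, ae_pos (p := p) hq0] with x h1 h2 h3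
  have hPl := P_meas (pi_meas hρ hρbar hρle) x.1
  rw [div_eq_mul_inv]
  have hNpos : ∀ n, 0 < (NN (Measure.infinitePi fun _ : ℕ => pm q) (KahaneSalem.π ρ) x
        (rr ρ ρbar n x)).toReal := fun n =>
    ENNReal.toReal_pos (NN_pos hρ hρbar hρle n x h3) (measure_ne_top _ _)
  refine interp (fun n => rr_pos hρ hρbar hρle n x) (rr_tendsto hρ hρbar hρle x)
    (rr_anti hρ hρbar hρle x) (fun n r hr1 hr2 => ?_) (fun n => ?_) h1 h2
  · rw [Measure.map_apply hPl measurableSet_ball]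
    have a1 : (NN (Measure.infinitePi fun _ : ℕ => pm q) (KahaneSalem.π ρ) x
        (rr ρ ρbar (n + 1) x)).toReal ≤ ((Measure.infinitePi fun _ : ℕ => pm q)
          (KahaneSalem.π ρ x.1 ⁻¹' ball (KahaneSalem.π ρ x.1 x.2) r)).toReal :=
      ENNReal.toReal_mono (measure_ne_top _ _)
        (measure_mono (preimage_mono (closedBall_subset_ball hr1)))
    have a2 : ((Measure.infinitePi fun _ : ℕ => pm q)
          (KahaneSalem.π ρ x.1 ⁻¹' ball (KahaneSalem.π ρ x.1 x.2) r)).toReal ≤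
        (NN (Measure.infinitePi fun _ : ℕ => pm q) (KahaneSalem.π ρ) x
        (rr ρ ρbar n x)).toReal :=
      ENNReal.toReal_mono (measure_ne_top _ _)
        (measure_mono (preimage_mono (ball_subset_closedBall.trans (closedBall_subset_closedBall hr2))))
    exact ⟨Real.log_le_log (hNpos _) a1, Real.log_le_log ((hNpos _).trans_le a1) a2⟩
  · refine Real.log_nonpos ENNReal.toReal_nonneg ?_
    have := ENNReal.toReal_mono ENNReal.one_ne_top
      (prob_le_one (μ := Measure.infinitePi fun _ : ℕ => pm q) (s := BB (KahaneSalem.π ρ) x (rr ρ ρbar n x)))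
    rw [ENNReal.toReal_one] at this
    exact this

lemma dim_le (hp0 : ∀ i, 0 ≤ p i) (hp1 : ∑' i, p i = 1) (hq0 : ∀ i, 0 ≤ q i) :
    projEnt θz (KahaneSalem.π ρ)
        ((Measure.infinitePi fun _ : ℤ => pm p).prod (Measure.infinitePi fun _ : ℕ => pm q)) /
          lyap θz (KahaneSalem.π ρ) (Dφ ρ)
          ((Measure.infinitePi fun _ : ℤ => pm p).prod (Measure.infinitePi fun _ : ℕ => pm q)) ≤
      (∑' i, p i * Real.log (p i) + ∑' j, q j * Real.log (q j)) / (∑' j, p j * Real.log (ρ j)) := by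
  have hP := pi_meas hρ hρbar hρle
  rw [lyap_eq hp0]
  have hS : 0 ≤ - ∑' j, p j * Real.log (ρ j) :=
    neg_nonneg.2 (tsum_nonpos fun j => mul_nonpos_of_nonneg_of_nonpos (hp0 j)
      (Real.log_nonpos (hρ j).1.le (hρ j).2.le))
  have hHP : ∑' i, p i * Real.log (p i) ≤ 0 :=
    tsum_nonpos fun j => mul_nonpos_of_nonneg_of_nonpos (hp0 j)
      (Real.log_nonpos (hp0 j) (q_le_one hp0 hp1 j))
  have hC := condEnt_nonneg ((Measure.infinitePi fun _ : ℤ => pm p).prod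
    (Measure.infinitePi fun _ : ℕ => pm q)) (algLpi (KahaneSalem.π ρ))
    (Measurable.comap_le (measurable_fst.prodMk hP))
  rw [← neg_div_neg_eq (∑' i, p i * Real.log (p i) + ∑' j, q j * Real.log (q j))]
  refine div_le_div_of_nonneg_right ?_ hS
  rw [projEnt, condEntT hP hq0]
  linarith

end Limits
end KSAux


/-- **Theorem (random system 4.1.2).**
With `μ = m_P × ν_Q` and the contractions `φ_n^λ(x) = ρ_{λ_n} x + (−1)^{λ₀}` on a
compact interval, for `μ`-a.e. `(λ,ω)` the projection `μ_λ∘π_λ⁻¹ = (π_λ)_* ν_Q` is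
exact dimensional at `π_λ(ω)` with dimension `h_μ(S(ρ̄))/χ_μ`, where
`χ_μ = −Σ_j p_j log ρ_j`, and this dimension is at most
`(Σ_i p_i log p_i + Σ_j q_j log q_j)/(Σ_j p_j log ρ_j)`. -/
theorem kahane_salem_random_system_dimension
    (ρ : ℕ → ℝ) (ρbar : ℝ) (hρ : ∀ i, ρ i ∈ Set.Ioo (0 : ℝ) 1)
    (hρbar : ρbar ∈ Set.Ioo (0 : ℝ) 1) (hρle : ∀ i, ρ i ≤ ρbar)
    (p : ℕ → ℝ) (hp0 : ∀ i, 0 ≤ p i) (hp1 : ∑' i, p i = 1)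
    (hpent : Summable fun i => Real.negMulLog (p i))
    (qv : ℕ → ℝ) (hq0 : ∀ i, 0 ≤ qv i) (hq1 : ∑' i, qv i = 1)
    (hqent : Summable fun i => Real.negMulLog (qv i))
    (mP : Measure (ℤ → ℕ)) [IsProbabilityMeasure mP]
    (hmP : ∀ (s : Finset ℤ) (a : ℤ → ℕ),
      mP {l | ∀ i ∈ s, l i = a i} = ∏ i ∈ s, ENNReal.ofReal (p (a i)))
    (νQ : Measure (ℕ → ℕ)) [IsProbabilityMeasure νQ]
    (hνQ : ∀ (n : ℕ) (a : Fin n → ℕ),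
      νQ {ω | ∀ i : Fin n, ω (i : ℕ) = a i} = ∏ i : Fin n, ENNReal.ofReal (qv (a i))) :
    (lyap θz (KahaneSalem.π ρ) (Dφ ρ) (mP.prod νQ) = - ∑' j, p j * Real.log (ρ j)) ∧
    ∀ᵐ pp ∂(mP.prod νQ),
      Tendsto
        (fun r : ℝ =>
          Real.log ((νQ.map (KahaneSalem.π ρ pp.1)
            (Metric.ball (KahaneSalem.π ρ pp.1 pp.2) r)).toReal) / Real.log r)
        (nhdsWithin 0 (Set.Ioi 0))
        (nhds (projEnt θz (KahaneSalem.π ρ) (mP.prod νQ) /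
          lyap θz (KahaneSalem.π ρ) (Dφ ρ) (mP.prod νQ))) ∧
      projEnt θz (KahaneSalem.π ρ) (mP.prod νQ) /
          lyap θz (KahaneSalem.π ρ) (Dφ ρ) (mP.prod νQ) ≤
        (∑' i, p i * Real.log (p i) + ∑' j, qv j * Real.log (qv j)) /
          (∑' j, p j * Real.log (ρ j)) := by
  have i1 := KSAux.pm_prob hp0 hp1
  have i2 := KSAux.pm_prob hq0 hq1
  obtain rfl : mP = Measure.infinitePi fun _ => KSAux.pm p := KSAux.eq_pi_of_cyl mP hmP
  obtain rfl : νQ = Measure.infinitePi fun _ => KSAux.pm qv := KSAux.eq_pi_of_cyl_nat νQ hνQ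
  refine ⟨KSAux.lyap_eq hp0, ?_⟩
  filter_upwards [KSAux.dim_tendsto (p := p) hρ hρbar hρle hq0 hq1 hqent] with x hx
  exact ⟨hx, KSAux.dim_le hρ hρbar hρle hp0 hp1 hq0⟩
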